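/- arXiv:2103.10117 — 3 statements merged into one kernel-verified Lean document; each statement's English description precedes it below -/
import Mathlib

section
/- Let Υ be a colored quiver with vertex set I, set B = ⊕_{s∈I} k e_s, and let d = (d_s) ∈ ℕ^I be a dimension vector. Then the representation scheme Rep(B(Υ), d) of the Boalch algebra relative to B is nonempty, and its dimension over k equals 2 Σ_{a∈Υ} d_{t(a)} d_{h(a)}, where t(a) and h(a) denote the tail and head of the arrow a. -/
open TensorProduct

namespace NCQP

variable (𝕜 : Type) [Field 𝕜] [CharZero 𝕜]

/-- A colored quiver on the ordered vertex set `Fin n`: a finite set of colors `C`, the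
vertex set `I_c ⊆ I` of each monochromatic subquiver, and the partition of `I_c` into
the parts of the complete multipartite graph, recorded by a labelling `part`. -/
structure ColoredQuiver (n : ℕ) where
  /-- the set of colors -/
  C : Type
  [fintC : Fintype C]
  [decC : DecidableEq C]
  /-- the vertex set `I_c` of the monochromatic subquiver of color `c` -/
  mem : C → Finset (Fin n)
  /-- the part of the partition of `I_c` containing a given vertex -/
  part : C → Fin n → ℕ

attribute [instance] ColoredQuiver.fintC ColoredQuiver.decC

namespace ColoredQuiver

variable {n : ℕ} (Q : ColoredQuiver n)

/-- There is an arrow of color `c` from `j` to `i` in the colored quiver `Υ`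
(one requires `j > i`, both vertices in `I_c`, lying in different parts; edges are
oriented from the larger to the smaller vertex). -/
def Arr (c : Q.C) (i j : Fin n) : Prop :=
  i < j ∧ i ∈ Q.mem c ∧ j ∈ Q.mem c ∧ Q.part c i ≠ Q.part c j

instance (c : Q.C) (i j : Fin n) : Decidable (Q.Arr c i j) := by
  unfold Arr; infer_instance

/-- There is an arrow of color `c` from `j` to `i` in the double `Ῡ`. -/
def DArr (c : Q.C) (i j : Fin n) : Prop :=
  i ≠ j ∧ i ∈ Q.mem c ∧ j ∈ Q.mem c ∧ Q.part c i ≠ Q.part c j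

instance (c : Q.C) (i j : Fin n) : Decidable (Q.DArr c i j) := by
  unfold DArr; infer_instance

end ColoredQuiver

/-- Generators of the path algebra of the extended double `Υ̃` of a colored quiver. -/
inductive BGen (n : ℕ) (C : Type) : Type
  | E : Fin n → BGen n C
  | V : C → Fin n → Fin n → BGen n C
  | W : C → Fin n → Fin n → BGen n C
  | G : C → Fin n → BGen n C
  | Gi : C → Fin n → BGen n C

section BoalchPresentation

variable {n : ℕ} (Q : ColoredQuiver n)

/-- Shorthands for the generators of the free algebra on `BGen`. -/
noncomputable abbrev bfE (i : Fin n) : FreeAlgebra 𝕜 (BGen n Q.C) :=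
  FreeAlgebra.ι 𝕜 (BGen.E i)
noncomputable abbrev bfV (c : Q.C) (i j : Fin n) : FreeAlgebra 𝕜 (BGen n Q.C) :=
  FreeAlgebra.ι 𝕜 (BGen.V c i j)
noncomputable abbrev bfW (c : Q.C) (i j : Fin n) : FreeAlgebra 𝕜 (BGen n Q.C) :=
  FreeAlgebra.ι 𝕜 (BGen.W c i j)
noncomputable abbrev bfG (c : Q.C) (i : Fin n) : FreeAlgebra 𝕜 (BGen n Q.C) :=
  FreeAlgebra.ι 𝕜 (BGen.G c i)
noncomputable abbrev bfGi (c : Q.C) (i : Fin n) : FreeAlgebra 𝕜 (BGen n Q.C) :=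
  FreeAlgebra.ι 𝕜 (BGen.Gi c i)

/-- The idempotent `1_{I_c}` of the subquiver of color `c`. -/
noncomputable def oneIc (c : Q.C) : FreeAlgebra 𝕜 (BGen n Q.C) :=
  ∑ i ∈ Q.mem c, bfE 𝕜 Q i

/-- `v_{c+} = 1_{I_c} + ∑_{i<j} v_{c,ij}`. -/
noncomputable def vcPlus (c : Q.C) : FreeAlgebra 𝕜 (BGen n Q.C) :=
  oneIc 𝕜 Q c + ∑ p ∈ Finset.univ.filter (fun p : Fin n × Fin n => p.1 < p.2),
    bfV 𝕜 Q c p.1 p.2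

/-- `v_{c-} = 1_{I_c} + ∑_{i>j} v_{c,ij}`. -/
noncomputable def vcMinus (c : Q.C) : FreeAlgebra 𝕜 (BGen n Q.C) :=
  oneIc 𝕜 Q c + ∑ p ∈ Finset.univ.filter (fun p : Fin n × Fin n => p.2 < p.1),
    bfV 𝕜 Q c p.1 p.2

/-- `w_{c+} = 1_{I_c} + ∑_{i<j} w_{c,ij}`. -/
noncomputable def wcPlus (c : Q.C) : FreeAlgebra 𝕜 (BGen n Q.C) :=
  oneIc 𝕜 Q c + ∑ p ∈ Finset.univ.filter (fun p : Fin n × Fin n => p.1 < p.2),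
    bfW 𝕜 Q c p.1 p.2

/-- `w_{c-} = 1_{I_c} + ∑_{i>j} w_{c,ij}`. -/
noncomputable def wcMinus (c : Q.C) : FreeAlgebra 𝕜 (BGen n Q.C) :=
  oneIc 𝕜 Q c + ∑ p ∈ Finset.univ.filter (fun p : Fin n × Fin n => p.2 < p.1),
    bfW 𝕜 Q c p.1 p.2

/-- `γ_c = ∑_{i ∈ I_c} γ_{c,i}`. -/
noncomputable def gamC (c : Q.C) : FreeAlgebra 𝕜 (BGen n Q.C) :=
  ∑ i ∈ Q.mem c, bfG 𝕜 Q c i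

/-- The defining relations of the Boalch algebra `B(Υ)`: the path algebra relations of
the extended double `Υ̃`, the local invertibility of the loops `γ_{c,i}`, and the
fission relations `v_{c-} v_{c+} = w_{c+} γ_c w_{c-}`. -/
inductive BoalchRel : FreeAlgebra 𝕜 (BGen n Q.C) → FreeAlgebra 𝕜 (BGen n Q.C) → Prop
  | orth (i j : Fin n) :
      BoalchRel (bfE 𝕜 Q i * bfE 𝕜 Q j) (if i = j then bfE 𝕜 Q i else 0)
  | sum_one : BoalchRel (∑ i : Fin n, bfE 𝕜 Q i) 1
  | vsupp (c : Q.C) (i j : Fin n) (h : Q.DArr c i j) :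
      BoalchRel (bfV 𝕜 Q c i j) (bfE 𝕜 Q i * bfV 𝕜 Q c i j * bfE 𝕜 Q j)
  | vzero (c : Q.C) (i j : Fin n) (h : ¬ Q.DArr c i j) :
      BoalchRel (bfV 𝕜 Q c i j) 0
  | wsupp (c : Q.C) (i j : Fin n) (h : i ≠ j ∧ i ∈ Q.mem c ∧ j ∈ Q.mem c) :
      BoalchRel (bfW 𝕜 Q c i j) (bfE 𝕜 Q i * bfW 𝕜 Q c i j * bfE 𝕜 Q j)
  | wzero (c : Q.C) (i j : Fin n) (h : ¬ (i ≠ j ∧ i ∈ Q.mem c ∧ j ∈ Q.mem c)) :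
      BoalchRel (bfW 𝕜 Q c i j) 0
  | gsupp (c : Q.C) (i : Fin n) (h : i ∈ Q.mem c) :
      BoalchRel (bfG 𝕜 Q c i) (bfE 𝕜 Q i * bfG 𝕜 Q c i * bfE 𝕜 Q i)
  | gzero (c : Q.C) (i : Fin n) (h : i ∉ Q.mem c) :
      BoalchRel (bfG 𝕜 Q c i) 0
  | gisupp (c : Q.C) (i : Fin n) (h : i ∈ Q.mem c) :
      BoalchRel (bfGi 𝕜 Q c i) (bfE 𝕜 Q i * bfGi 𝕜 Q c i * bfE 𝕜 Q i)
  | gizero (c : Q.C) (i : Fin n) (h : i ∉ Q.mem c) :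
      BoalchRel (bfGi 𝕜 Q c i) 0
  | ginv (c : Q.C) (i : Fin n) (h : i ∈ Q.mem c) :
      BoalchRel (bfG 𝕜 Q c i * bfGi 𝕜 Q c i) (bfE 𝕜 Q i)
  | ginv' (c : Q.C) (i : Fin n) (h : i ∈ Q.mem c) :
      BoalchRel (bfGi 𝕜 Q c i * bfG 𝕜 Q c i) (bfE 𝕜 Q i)
  | main (c : Q.C) :
      BoalchRel (vcMinus 𝕜 Q c * vcPlus 𝕜 Q c)
        (wcPlus 𝕜 Q c * gamC 𝕜 Q c * wcMinus 𝕜 Q c)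

/-- The Boalch algebra `B(Υ)` of a colored quiver `Υ`. -/
abbrev Boalch : Type := RingQuot (BoalchRel 𝕜 Q)

/-- The idempotents `e_i ∈ B(Υ)`. -/
noncomputable def bE (i : Fin n) : Boalch 𝕜 Q :=
  RingQuot.mkAlgHom 𝕜 (BoalchRel 𝕜 Q) (bfE 𝕜 Q i)
/-- The arrows `v_{c,ij} ∈ B(Υ)`. -/
noncomputable def bV (c : Q.C) (i j : Fin n) : Boalch 𝕜 Q :=
  RingQuot.mkAlgHom 𝕜 (BoalchRel 𝕜 Q) (bfV 𝕜 Q c i j)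
/-- The arrows `w_{c,ij} ∈ B(Υ)`. -/
noncomputable def bW (c : Q.C) (i j : Fin n) : Boalch 𝕜 Q :=
  RingQuot.mkAlgHom 𝕜 (BoalchRel 𝕜 Q) (bfW 𝕜 Q c i j)
/-- The loops `γ_{c,i} ∈ B(Υ)`. -/
noncomputable def bG (c : Q.C) (i : Fin n) : Boalch 𝕜 Q :=
  RingQuot.mkAlgHom 𝕜 (BoalchRel 𝕜 Q) (bfG 𝕜 Q c i)
/-- The inverse loops `γ_{c,i}⁻¹ ∈ B(Υ)`. -/
noncomputable def bGi (c : Q.C) (i : Fin n) : Boalch 𝕜 Q :=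
  RingQuot.mkAlgHom 𝕜 (BoalchRel 𝕜 Q) (bfGi 𝕜 Q c i)

end BoalchPresentation

/-- Generators of the path algebra of the double `Ῡ` of a colored quiver. -/
inductive DGen (n : ℕ) (C : Type) : Type
  | E : Fin n → DGen n C
  | V : C → Fin n → Fin n → DGen n C

section DoublePresentation

variable {n : ℕ} (Q : ColoredQuiver n)

/-- The defining relations of the path algebra `𝕜Ῡ` of the double of a colored
quiver. -/
inductive DblRel : FreeAlgebra 𝕜 (DGen n Q.C) → FreeAlgebra 𝕜 (DGen n Q.C) → Prop
  | orth (i j : Fin n) :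
      DblRel (FreeAlgebra.ι 𝕜 (DGen.E i) * FreeAlgebra.ι 𝕜 (DGen.E j))
        (if i = j then FreeAlgebra.ι 𝕜 (DGen.E i) else 0)
  | sum_one : DblRel (∑ i : Fin n, FreeAlgebra.ι 𝕜 (DGen.E i)) 1
  | vsupp (c : Q.C) (i j : Fin n) (h : Q.DArr c i j) :
      DblRel (FreeAlgebra.ι 𝕜 (DGen.V c i j))
        (FreeAlgebra.ι 𝕜 (DGen.E i) * FreeAlgebra.ι 𝕜 (DGen.V c i j) *
          FreeAlgebra.ι 𝕜 (DGen.E j))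
  | vzero (c : Q.C) (i j : Fin n) (h : ¬ Q.DArr c i j) :
      DblRel (FreeAlgebra.ι 𝕜 (DGen.V c i j)) 0

/-- The path algebra `𝕜Ῡ` of the double of a colored quiver. -/
abbrev DblPath : Type := RingQuot (DblRel 𝕜 Q)

/-- The idempotents `e_i ∈ 𝕜Ῡ`. -/
noncomputable def dE (i : Fin n) : DblPath 𝕜 Q :=
  RingQuot.mkAlgHom 𝕜 (DblRel 𝕜 Q) (FreeAlgebra.ι 𝕜 (DGen.E i))
/-- The arrows `v_{c,ij} ∈ 𝕜Ῡ`. -/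
noncomputable def dV (c : Q.C) (i j : Fin n) : DblPath 𝕜 Q :=
  RingQuot.mkAlgHom 𝕜 (DblRel 𝕜 Q) (FreeAlgebra.ι 𝕜 (DGen.V c i j))

end DoublePresentation

variable {𝕜} in
/-- The index set of matrix entries for the dimension vector `d`, i.e. the basis of
`⊕_s 𝕜^{d_s}` with its block structure. -/
abbrev Idx {n : ℕ} (d : Fin n → ℕ) : Type := (s : Fin n) × Fin (d s)

/-- The defining ideal of the representation algebra `A_d` of an algebra `A` relative to
`B`, on the generating symbols `a_{ij}`; `ee` is the family of idempotents of `A`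
giving the `B`-algebra structure. -/
noncomputable def repIdeal {n : ℕ} (A : Type) [Ring A] [Algebra 𝕜 A] (ee : Fin n → A)
    (d : Fin n → ℕ) : Ideal (MvPolynomial (A × Idx d × Idx d) 𝕜) :=
  Ideal.span
    ( {P | ∃ (a b : A) (i j : Idx d),
        P = MvPolynomial.X (a + b, i, j) - MvPolynomial.X (a, i, j)
          - MvPolynomial.X (b, i, j)}
    ∪ {P | ∃ (c : 𝕜) (a : A) (i j : Idx d),
        P = MvPolynomial.X (c • a, i, j) - MvPolynomial.C c * MvPolynomial.X (a, i, j)}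
    ∪ {P | ∃ (a b : A) (i j : Idx d),
        P = MvPolynomial.X (a * b, i, j)
          - ∑ l : Idx d, MvPolynomial.X (a, i, l) * MvPolynomial.X (b, l, j)}
    ∪ {P | ∃ (s : Fin n) (i j : Idx d),
        P = MvPolynomial.X (ee s, i, j) - if i = j ∧ i.1 = s then 1 else 0} )

/-- The representation algebra `A_d`, i.e. the coordinate ring of the representation
scheme `Rep(A, d)` relative to `B`. -/
abbrev RepAlg {n : ℕ} (A : Type) [Ring A] [Algebra 𝕜 A] (ee : Fin n → A)
    (d : Fin n → ℕ) : Type :=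
  MvPolynomial (A × Idx d × Idx d) 𝕜 ⧸ repIdeal 𝕜 A ee d

set_option linter.unusedSectionVars false

/-- The Krull dimension does not increase under localization. -/
theorem ringKrullDim_le_of_isLocalization {R : Type*} [CommRing R] (M : Submonoid R)
    (S : Type*) [CommRing S] [Algebra R S] [IsLocalization M S] :
    ringKrullDim S ≤ ringKrullDim R :=
  Order.krullDim_le_of_strictMono (PrimeSpectrum.comap (algebraMap R S))
    (Monotone.strictMono_of_injective (fun _ _ h => Ideal.comap_mono h)
      (PrimeSpectrum.localization_comap_injective S M))

/-- The Krull dimension of a principal open neighbourhood of the origin in affine space is at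
least the dimension of the affine space. -/
theorem natCard_le_ringKrullDim_away {k : Type*} [Field k] (σ : Type) [Finite σ] :
    ∀ (f : MvPolynomial σ k), MvPolynomial.constantCoeff f ≠ 0 →
      (Nat.card σ : WithBot ℕ∞) ≤ ringKrullDim (Localization.Away f) := by
  induction σ using Finite.induction_empty_option with
  | of_equiv e H =>
    intro f hf
    set g := MvPolynomial.rename e.symm f with hg
    have hfg : MvPolynomial.renameEquiv k e g = f := by
      simp [hg, MvPolynomial.rename_rename]
    have hg0 : MvPolynomial.constantCoeff g ≠ 0 := by
      simpa [hg, MvPolynomial.constantCoeff_rename] using hf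
    rw [← Nat.card_congr e]
    refine (H g hg0).trans_eq ?_
    refine ringKrullDim_eq_of_ringEquiv (IsLocalization.ringEquivOfRingEquiv
      (M := Submonoid.powers g) (T := Submonoid.powers f) _ _
      (MvPolynomial.renameEquiv k e).toRingEquiv ?_)
    have := Submonoid.map_powers
      ((MvPolynomial.renameEquiv k e).toRingEquiv.toMonoidHom) g
    refine this.trans ?_
    exact congrArg Submonoid.powers hfg
  | h_empty =>
    intro f hf
    have : Nontrivial (Localization.Away f) := by
      have := IsLocalization.isDomain_localization (M := Submonoid.powers f)
        (powers_le_nonZeroDivisors_of_noZeroDivisors fun h => hf (by simp [h]))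
      infer_instance
    simp only [Nat.card_eq_fintype_card, Fintype.card_eq_zero, Nat.cast_zero]
    exact ringKrullDim_nonneg_of_nontrivial
  | @h_option α _ IH =>
    intro f hf
    let π : MvPolynomial (Option α) k →ₐ[k] MvPolynomial α k :=
      MvPolynomial.aeval fun o => o.elim 0 MvPolynomial.X
    have hπ0 : MvPolynomial.constantCoeff (π f) = MvPolynomial.constantCoeff f := by
      have : (MvPolynomial.constantCoeff (σ := α) (R := k)).comp π.toRingHom
          = MvPolynomial.constantCoeff := by
        refine MvPolynomial.ringHom_ext (by simp [π]) ?_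
        rintro (_ | _) <;> simp [π]
      exact RingHom.congr_fun this f
    have hπs : Function.Surjective π := fun p =>
      ⟨MvPolynomial.rename some p, by
        simp only [π, MvPolynomial.aeval_rename]
        exact MvPolynomial.aeval_X_left_apply p⟩
    have hle : Submonoid.powers f ≤ (Submonoid.powers (π f)).comap π.toRingHom := by
      rw [Submonoid.powers_le]
      exact Submonoid.mem_powers (π f)
    let F : Localization.Away f →+* Localization.Away (π f) :=
      IsLocalization.map _ π.toRingHom hle
    have hF : Function.Surjective F := by
      intro z
      obtain ⟨p, ⟨_, m, rfl⟩, rfl⟩ := IsLocalization.exists_mk'_eq (Submonoid.powers (π f)) z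
      obtain ⟨q, rfl⟩ := hπs p
      refine ⟨IsLocalization.mk' _ q (⟨f ^ m, m, rfl⟩ : Submonoid.powers f), ?_⟩
      simp only [F, IsLocalization.map_mk']
      congr 1
      ext
      simp
    have hf0 : f ≠ 0 := fun h => hf (by simp [h])
    have hM : Submonoid.powers f ≤ nonZeroDivisors (MvPolynomial (Option α) k) :=
      powers_le_nonZeroDivisors_of_noZeroDivisors hf0
    have := IsLocalization.isDomain_localization hM
    have key := ringKrullDim_succ_le_of_surjective F hF
      (r := algebraMap _ _ (MvPolynomial.X none : MvPolynomial (Option α) k))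
      (mem_nonZeroDivisors_of_ne_zero fun h =>
        MvPolynomial.X_ne_zero (R := k) (none : Option α)
          ((IsLocalization.injective (Localization.Away f) hM) (h.trans (map_zero _).symm)))
      (by
        refine (IsLocalization.map_eq hle _).trans ?_
        have : π (MvPolynomial.X none) = 0 := MvPolynomial.aeval_X _ _
        exact (congrArg _ this).trans (map_zero _))
    refine le_trans ?_ key
    have := IH (π f) (hπ0 ▸ hf)
    simp only [Nat.card_eq_fintype_card, Fintype.card_option, Nat.cast_add, Nat.cast_one] at this ⊢
    gcongr

theorem ringKrullDim_away_eq_natCard {k : Type*} [Field k] (σ : Type) [Finite σ]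
    (f : MvPolynomial σ k) (hf : MvPolynomial.constantCoeff f ≠ 0) :
    ringKrullDim (Localization.Away f) = Nat.card σ := by
  refine le_antisymm ?_ (natCard_le_ringKrullDim_away σ f hf)
  refine (ringKrullDim_le_of_isLocalization (Submonoid.powers f) _).trans ?_
  rw [MvPolynomial.ringKrullDim_of_isNoetherianRing, ringKrullDim_eq_zero_of_field, zero_add]

section Corner

variable {A : Type*} [Ring A] {q a b : A}

/-- `1 - q + q a q` for an idempotent `q`: the element acting as `q a q` on the image of `q`
and as the identity on its complement. -/
def compress (q a : A) : A := 1 - q + q * a * q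

theorem compress_mul_compress (hq : q * q = q) (h : q * a * q = q * a ∨ q * b * q = b * q) :
    compress q a * compress q b = compress q (a * b) := by
  have h1 : (1 - q + q * a * q) * (1 - q + q * b * q) = 1 - q + (q * a * q) * (q * b * q) := by
    have e1 : (1 - q) * (1 - q) = 1 - q := by
      rw [mul_sub, mul_one, sub_mul, one_mul, hq, sub_self, sub_zero]
    have e2 : (1 - q) * (q * b * q) = 0 := by
      rw [sub_mul, one_mul, mul_assoc q, ← mul_assoc q q, hq, sub_self]
    have e3 : (q * a * q) * (1 - q) = 0 := by
      rw [mul_sub, mul_one, mul_assoc (q * a), hq, sub_self]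
    rw [add_mul, mul_add, mul_add, e1, e2, e3, zero_add, add_zero]
  unfold compress
  rw [h1]
  congr 1
  rcases h with h | h
  · rw [h]
    calc q * a * (q * b * q) = (q * a * q) * b * q := by noncomm_ring
      _ = _ := by rw [h]; noncomm_ring
  · rw [h]
    calc q * a * q * (b * q) = q * a * (q * b * q) := by noncomm_ring
      _ = _ := by rw [h]; noncomm_ring

theorem mul_compress_inverse (hq : q * q = q) (h : b * compress q a = 1) :
    q * b * q * a * q = q := by
  have : compress q a * q = q * a * q := by
    rw [compress, add_mul, sub_mul, one_mul, hq, sub_self, zero_add, mul_assoc, hq]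
  calc q * b * q * a * q = q * b * (q * a * q) := by simp only [mul_assoc]
    _ = q * (b * compress q a) * q := by rw [← this]; simp only [mul_assoc]
    _ = q := by rw [h, mul_one, hq]

theorem mul_compress_inverse' (hq : q * q = q) (h : compress q a * b = 1) :
    q * a * q * b * q = q := by
  have : q * compress q a = q * a * q := by
    rw [compress, mul_add, mul_sub, mul_one, hq, sub_self, zero_add, ← mul_assoc, ← mul_assoc, hq]
  calc q * a * q * b * q = q * (compress q a * b) * q := by rw [← this]; simp only [mul_assoc]
    _ = q := by rw [h, mul_one, hq]

/-- `a` acts as the identity on the image of the idempotent `q`. -/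
def Fixes (q a : A) : Prop := q * a = q ∧ a * q = q

theorem Fixes.mul (ha : Fixes q a) (hb : Fixes q b) : Fixes q (a * b) :=
  ⟨by rw [← mul_assoc, ha.1, hb.1], by rw [mul_assoc, hb.2, ha.2]⟩

theorem Fixes.of_inverse (ha : Fixes q a) (h : a * b = 1) (h' : b * a = 1) : Fixes q b :=
  ⟨by rw [← ha.1, mul_assoc, h, mul_one, ha.1], by rw [← ha.2, ← mul_assoc, h', one_mul, ha.2]⟩

theorem Fixes.sub_mul_sub (ha : Fixes q a) (hb : Fixes q b) (hq : q * q = q) :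
    (a - q) * (b - q) = a * b - q := by
  rw [sub_mul, mul_sub, mul_sub, ha.2, hb.1, hq, sub_self, sub_zero]

theorem fixes_add (hq : q * q = q) (h : q * a = 0) (h' : a * q = 0) : Fixes q (a + q) :=
  ⟨by rw [mul_add, h, hq, zero_add], by rw [add_mul, h', hq, zero_add]⟩

theorem Fixes.compress {e : A} (ha : Fixes e a) (hq : q * q = q) (he : e * q = q * e) :
    Fixes e (compress q a) := by
  constructor
  · have : e * (q * a * q) = e * q := by
      calc e * (q * a * q) = (e * q) * a * q := by simp only [mul_assoc]
        _ = q * (e * a) * q := by rw [he]; simp only [mul_assoc]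
        _ = e * q := by rw [ha.1, ← he, mul_assoc, hq]
    rw [NCQP.compress, mul_add, mul_sub, this, mul_one, sub_add_cancel]
  · have : q * a * q * e = q * e := by
      calc q * a * q * e = q * a * (q * e) := by simp only [mul_assoc]
        _ = q * (a * e) * q := by rw [← he]; simp only [mul_assoc]
        _ = q * e := by rw [ha.2, mul_assoc, he, ← mul_assoc, hq]
    rw [NCQP.compress, add_mul, sub_mul, this, one_mul, sub_add_cancel]

end Corner

section UDL

open Matrix

variable {S : Type*} [CommRing S] {m α : Type*} [Fintype m] [DecidableEq m]
  [LinearOrder α] (b : m → α)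

/-- Block upper unitriangular matrices. -/
def UpperUni (U : Matrix m m S) : Prop := ∀ x y, b y ≤ b x → U x y = (1 : Matrix m m S) x y

/-- Block lower unitriangular matrices. -/
def LowerUni (L : Matrix m m S) : Prop := ∀ x y, b x ≤ b y → L x y = (1 : Matrix m m S) x y

/-- Block diagonal matrices. -/
def BlockDiag (D : Matrix m m S) : Prop := ∀ x y, b x ≠ b y → D x y = 0

variable {b}

theorem LowerUni.transpose {L : Matrix m m S} (h : LowerUni b L) : UpperUni b Lᵀ := fun x y hxy =>
  by rw [transpose_apply, h y x hxy, one_apply, one_apply]; simp only [eq_comm]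

theorem UpperUni.transpose {L : Matrix m m S} (h : UpperUni b L) : LowerUni b Lᵀ := fun x y hxy =>
  by rw [transpose_apply, h y x hxy, one_apply, one_apply]; simp only [eq_comm]

theorem BlockDiag.transpose {D : Matrix m m S} (h : BlockDiag b D) : BlockDiag b Dᵀ :=
  fun x y hxy => h y x hxy.symm

theorem BlockDiag.blockTriangular {D : Matrix m m S} (h : BlockDiag b D) : D.BlockTriangular b :=
  fun x y hxy => h x y hxy.ne'

theorem UpperUni.blockTriangular {U : Matrix m m S} (h : UpperUni b U) : U.BlockTriangular b :=
  fun x y hxy => by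
    rw [h x y hxy.le, one_apply_ne]
    rintro rfl
    exact lt_irrefl _ hxy

theorem UpperUni.mul_apply_of_le {U T : Matrix m m S} (hU : UpperUni b U)
    (hT : T.BlockTriangular b) {x y : m} (hxy : b y ≤ b x) : (U * T) x y = T x y := by
  rw [mul_apply, Finset.sum_eq_single x]
  · rw [hU x x le_rfl, one_apply_eq, one_mul]
  · intro z _ hz
    rcases le_or_gt (b z) (b x) with h | h
    · rw [hU x z h, one_apply_ne hz.symm, zero_mul]
    · rw [hT (hxy.trans_lt h), mul_zero]
  · simp

theorem UpperUni.mul {U V : Matrix m m S} (hU : UpperUni b U) (hV : UpperUni b V) :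
    UpperUni b (U * V) := fun x y hxy => by
  rw [hU.mul_apply_of_le hV.blockTriangular hxy, hV x y hxy]

theorem UpperUni.det_eq_one {U : Matrix m m S} (hU : UpperUni b U) : U.det = 1 := by
  classical
  rw [hU.blockTriangular.det]
  refine Finset.prod_eq_one fun a _ => ?_
  have : U.toSquareBlock b a = 1 := by
    ext ⟨x, hx⟩ ⟨y, hy⟩
    rw [toSquareBlock_def, of_apply, hU x y (hy.trans hx.symm).le, one_apply, one_apply]
    simp
  rw [this, det_one]

theorem UpperUni.mul_inv {U : Matrix m m S} (hU : UpperUni b U) : U * U⁻¹ = 1 :=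
  mul_nonsing_inv _ (by rw [hU.det_eq_one]; exact isUnit_one)

theorem UpperUni.inv_mul {U : Matrix m m S} (hU : UpperUni b U) : U⁻¹ * U = 1 :=
  nonsing_inv_mul _ (by rw [hU.det_eq_one]; exact isUnit_one)

theorem UpperUni.inv {U : Matrix m m S} (hU : UpperUni b U) : UpperUni b U⁻¹ := fun x y hxy => by
  have : Invertible U := invertibleOfRightInverse _ _ hU.mul_inv
  rw [← hU.mul_apply_of_le (blockTriangular_inv_of_blockTriangular hU.blockTriangular) hxy,
    hU.mul_inv]

theorem LowerUni.det_eq_one {L : Matrix m m S} (hL : LowerUni b L) : L.det = 1 := by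
  rw [← det_transpose, hL.transpose.det_eq_one]

theorem LowerUni.mul_inv {L : Matrix m m S} (hL : LowerUni b L) : L * L⁻¹ = 1 :=
  mul_nonsing_inv _ (by rw [hL.det_eq_one]; exact isUnit_one)

theorem LowerUni.inv_mul {L : Matrix m m S} (hL : LowerUni b L) : L⁻¹ * L = 1 :=
  nonsing_inv_mul _ (by rw [hL.det_eq_one]; exact isUnit_one)

theorem LowerUni.inv {L : Matrix m m S} (hL : LowerUni b L) : LowerUni b L⁻¹ := by
  have := hL.transpose.inv.transpose
  rwa [transpose_nonsing_inv, transpose_transpose] at this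

theorem LowerUni.mul {K L : Matrix m m S} (hK : LowerUni b K) (hL : LowerUni b L) :
    LowerUni b (K * L) := by
  simpa using (hL.transpose.mul hK.transpose).transpose

theorem LowerUni.mul_apply_of_le {L T : Matrix m m S} (hL : LowerUni b L)
    (hT : Tᵀ.BlockTriangular b) {x y : m} (hxy : b x ≤ b y) : (T * L) x y = T x y := by
  have := hL.transpose.mul_apply_of_le hT hxy
  rwa [← transpose_mul] at this

/-- Uniqueness of the block factorization into an upper unitriangular, a diagonal and a lower
unitriangular matrix. -/
theorem udl_unique {U D L U' D' L' : Matrix m m S}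
    (hU : UpperUni b U) (hD : BlockDiag b D) (hL : LowerUni b L)
    (hU' : UpperUni b U') (hD' : BlockDiag b D') (hL' : LowerUni b L')
    (hu : IsUnit D) (h : U * D * L = U' * D' * L') : U = U' ∧ D = D' ∧ L = L' := by
  set N := U'⁻¹ * U with hN
  set K := L' * L⁻¹ with hK
  have hNK : N * D = D' * K := by
    calc N * D = U'⁻¹ * (U * D * L) * L⁻¹ := by
          rw [hN, mul_assoc, mul_assoc, mul_assoc, mul_assoc, hL.mul_inv, mul_one]
      _ = (U'⁻¹ * U') * (D' * K) := by rw [h, hK]; simp only [mul_assoc]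
      _ = D' * K := by rw [hU'.inv_mul, one_mul]
  have h1 : ∀ x y, b y ≤ b x → (N * D) x y = D x y := fun x y hxy =>
    (hU'.inv.mul hU).mul_apply_of_le hD.blockTriangular hxy
  have h2 : ∀ x y, b x ≤ b y → (D' * K) x y = D' x y := fun x y hxy =>
    (hL'.mul hL.inv).mul_apply_of_le hD'.transpose.blockTriangular hxy
  have hDD : D = D' := by
    ext x y
    by_cases hxy : b x = b y
    · rw [← h1 x y hxy.ge, hNK, h2 x y hxy.le]
    · rw [hD x y hxy, hD' x y hxy]
  have hND : N * D = D := by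
    ext x y
    rcases le_total (b x) (b y) with hxy | hxy
    · rw [hNK, h2 x y hxy, hDD]
    · exact h1 x y hxy
  have hN1 : N = 1 := hu.mul_right_cancel (hND.trans (one_mul D).symm)
  have hUU : U = U' := by
    rw [← one_mul U, ← hU'.mul_inv, mul_assoc, ← hN, hN1, mul_one]
  refine ⟨hUU, hDD, ?_⟩
  have hUD : IsUnit (U * D) := (IsUnit.of_mul_eq_one _ hU.mul_inv).mul hu
  refine hUD.mul_left_cancel ?_
  rw [h, hUU, hDD]

variable (b) in
/-- The projection onto the blocks of index larger than `k`. -/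
def above (k : α) : Matrix m m S := diagonal fun x => if k < b x then 1 else 0

theorem above_mul_above (k : α) : above b k * above b k = (above b k : Matrix m m S) := by
  rw [above, diagonal_mul_diagonal]
  congr 1
  ext x
  split_ifs <;> simp

theorem compress_above_apply (k : α) (M : Matrix m m S) (x y : m) :
    compress (above b k) M x y = if k < b x ∧ k < b y then M x y else (1 : Matrix m m S) x y := by
  have : ((above b k * M * above b k : Matrix m m S)) x y
      = (if k < b x then 1 else 0) * M x y * (if k < b y then 1 else 0) := by
    rw [above, mul_diagonal, diagonal_mul]
  rw [compress, Matrix.add_apply, this, Matrix.sub_apply, above, diagonal_apply, one_apply]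
  rcases eq_or_ne x y with rfl | h
  · by_cases hx : k < b x <;> simp only [hx, if_true, if_false, and_self] <;> ring
  · simp only [h, if_false, ite_and, ite_mul, mul_ite, one_mul, zero_mul, mul_one, mul_zero]
    split_ifs <;> ring

variable (b) in
/-- The product of the trailing principal block minors. -/
def minorProd [Fintype α] (M : Matrix m m S) : S :=
  M.det * ∏ k, (compress (above b k) M).det

theorem UpperUni.compress {U : Matrix m m S} (hU : UpperUni b U) (k : α) :
    UpperUni b (compress (above b k) U) := fun x y hxy => by
  rw [compress_above_apply]
  split_ifs
  · exact hU x y hxy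
  · rfl

theorem LowerUni.compress {L : Matrix m m S} (hL : LowerUni b L) (k : α) :
    LowerUni b (compress (above b k) L) := fun x y hxy => by
  rw [compress_above_apply]
  split_ifs
  · exact hL x y hxy
  · rfl

theorem above_mul_mul_above {T : Matrix m m S} (hT : T.BlockTriangular b) (k : α) :
    above b k * T * above b k = above b k * T := by
  ext x y
  rw [above, mul_diagonal, diagonal_mul]
  by_cases hx : k < b x <;> by_cases hy : k < b y <;> simp only [hx, hy, if_true, if_false,
    one_mul, mul_one, zero_mul, mul_zero]
  exact (hT ((not_lt.1 hy).trans_lt hx)).symm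

theorem above_mul_mul_above' {T : Matrix m m S} (hT : Tᵀ.BlockTriangular b) (k : α) :
    above b k * T * above b k = T * above b k := by
  have := congrArg Matrix.transpose (above_mul_mul_above hT k)
  simpa [above, mul_assoc] using this

theorem isUnit_minorProd [Fintype α] {U D D' L : Matrix m m S} (hU : UpperUni b U)
    (hD : BlockDiag b D) (hL : LowerUni b L) (h : D * D' = 1) :
    IsUnit (minorProd b (U * D * L)) := by
  have hdet : ∀ {M N : Matrix m m S}, M * N = 1 → IsUnit M.det := fun h =>
    IsUnit.of_mul_eq_one _ (by rw [← det_mul, h, det_one])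
  refine IsUnit.mul ?_ ?_
  · rw [det_mul, det_mul, hU.det_eq_one, hL.det_eq_one, one_mul, mul_one]
    exact hdet h
  · refine IsUnit.prod_univ_iff.2 fun k => ?_
    rw [← compress_mul_compress (above_mul_above k)
        (Or.inr (above_mul_mul_above' hL.transpose.blockTriangular k)),
      ← compress_mul_compress (above_mul_above k)
        (Or.inl (above_mul_mul_above hU.blockTriangular k)),
      det_mul, det_mul, (hU.compress k).det_eq_one, (hL.compress k).det_eq_one, one_mul, mul_one]
    refine hdet (N := NCQP.compress (above b k) D') ?_
    rw [compress_mul_compress (above_mul_above k)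
        (Or.inl (above_mul_mul_above hD.blockTriangular k)), h, NCQP.compress, mul_one,
      above_mul_above, sub_add_cancel]

/-- Existence of the block factorization into an upper unitriangular, a diagonal and a lower
unitriangular matrix, together with the fact that the factors act as the identity on those
blocks on which the given matrix does. -/
theorem exists_udl [Fintype α] {M : Matrix m m S} (hM : IsUnit (minorProd b M)) {p : α → Prop}
    [DecidablePred p] (hp : Fixes (diagonal fun x => if p (b x) then 1 else 0) M) :
    ∃ U D D' L : Matrix m m S, UpperUni b U ∧ BlockDiag b D ∧ BlockDiag b D' ∧ LowerUni b L ∧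
      D * D' = 1 ∧ D' * D = 1 ∧ U * D * L = M ∧
      Fixes (diagonal fun x => if p (b x) then 1 else 0) U ∧
      Fixes (diagonal fun x => if p (b x) then 1 else 0) D ∧
      Fixes (diagonal fun x => if p (b x) then 1 else 0) L := by
  set K : Matrix m m S := diagonal fun x => if p (b x) then 1 else 0 with hK
  have hunit := isUnit_of_mul_isUnit_left hM
  have hcorner : ∀ k, IsUnit (compress (above b k) M).det :=
    IsUnit.prod_univ_iff.1 (isUnit_of_mul_isUnit_right hM)
  set q : α → Matrix m m S := above b with hq
  set s : α → Matrix m m S := fun k => (compress (q k) M)⁻¹ with hs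
  have hqq : ∀ k, q k * q k = q k := above_mul_above
  have hst : ∀ k, s k * compress (q k) M = 1 := fun k => nonsing_inv_mul _ (hcorner k)
  have hts : ∀ k, compress (q k) M * s k = 1 := fun k => mul_nonsing_inv _ (hcorner k)
  have hKq : ∀ k, K * q k = q k * K := fun k => by
    rw [hK, hq, above, diagonal_mul_diagonal, diagonal_mul_diagonal]
    simp only [mul_comm]
  have hKs : ∀ k, Fixes K (s k) := fun k =>
    (hp.compress (hqq k) (hKq k)).of_inverse (hts k) (hst k)
  have hKqsq : ∀ k, K * (q k * s k * q k) = K * q k := fun k => by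
    calc K * (q k * s k * q k) = (K * q k) * s k * q k := by simp only [mul_assoc]
      _ = q k * (K * s k) * q k := by rw [hKq]; simp only [mul_assoc]
      _ = K * q k := by rw [(hKs k).1, ← hKq, mul_assoc, hqq]
  have hqsqK : ∀ k, q k * s k * q k * K = K * q k := fun k => by
    calc q k * s k * q k * K = q k * s k * (q k * K) := by simp only [mul_assoc]
      _ = q k * (s k * K) * q k := by rw [← hKq]; simp only [mul_assoc]
      _ = K * q k := by rw [(hKs k).2, mul_assoc, hKq, ← mul_assoc, hqq]
  set R : α → Matrix m m S := fun k => 1 - M * (q k * s k * q k) with hR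
  set T : α → Matrix m m S := fun k => 1 - (q k * s k * q k) * M with hT
  set U : Matrix m m S := Matrix.of fun x y => R (b x) x y with hU
  set L : Matrix m m S := Matrix.of fun x y => T (b y) x y with hL
  have hUX : ∀ (X : Matrix m m S) x y, (U * X) x y = (R (b x) * X) x y := fun X x y => by
    simp only [mul_apply, hU, of_apply]
  have hXL : ∀ (X : Matrix m m S) x y, (X * L) x y = (X * T (b y)) x y := fun X x y => by
    simp only [mul_apply, hL, of_apply]
  have hUu : UpperUni b U := fun x y hxy => by
    have : (M * (q (b x) * s (b x) * q (b x))) x y = 0 := by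
      rw [← mul_assoc, hq, above, mul_diagonal, if_neg (not_lt.2 hxy), mul_zero]
    change (1 - M * (q (b x) * s (b x) * q (b x))) x y = _
    rw [Matrix.sub_apply, this, sub_zero]
  have hLl : LowerUni b L := fun x y hxy => by
    have : (q (b y) * s (b y) * q (b y) * M) x y = 0 := by
      rw [mul_assoc, mul_assoc, hq, above, diagonal_mul, if_neg (not_lt.2 hxy), zero_mul]
    change (1 - q (b y) * s (b y) * q (b y) * M) x y = _
    rw [Matrix.sub_apply, this, sub_zero]
  have hUM : (U * M)ᵀ.BlockTriangular b := fun y x hxy => by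
    have h0 : R (b x) * M * q (b x) = 0 := by
      calc R (b x) * M * q (b x)
          = M * q (b x) - M * (q (b x) * s (b x) * q (b x) * M * q (b x)) := by
            simp only [hR, sub_mul, one_mul, mul_assoc]
        _ = 0 := by rw [mul_compress_inverse (hqq _) (hst _), sub_self]
    have h1 := congrFun (congrFun h0 x) y
    rw [hq, above, mul_diagonal, if_pos hxy, mul_one] at h1
    rw [transpose_apply, hUX, h1, Matrix.zero_apply]
  have hML : (M * L).BlockTriangular b := fun x y hxy => by
    have h0 : q (b y) * (M * T (b y)) = 0 := by
      calc q (b y) * (M * T (b y))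
          = q (b y) * M - q (b y) * M * q (b y) * s (b y) * q (b y) * M := by
            simp only [hT, mul_sub, mul_one, mul_assoc]
        _ = 0 := by rw [mul_compress_inverse' (hqq _) (hts _), sub_self]
    have h1 := congrFun (congrFun h0 x) y
    rw [hq, above, diagonal_mul, if_pos hxy, one_mul] at h1
    rw [hXL, h1, Matrix.zero_apply]
  have hZ : ∀ x y k, k = b x ∨ k = b y → (K - K * q k) x y = K x y := fun x y k hk => by
    have : (K * q k) x y = 0 := by
      rw [hK, hq, above, diagonal_mul_diagonal, diagonal_apply]
      split_ifs with h1 h2 h3 <;> simp_all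
    rw [Matrix.sub_apply, this, sub_zero]
  have hKR : ∀ k, K * R k = K - K * q k := fun k => by
    rw [hR, mul_sub, mul_one, ← mul_assoc, hp.1, hKqsq]
  have hRK : ∀ k, R k * K = K - K * q k := fun k => by
    rw [hR, sub_mul, one_mul, mul_assoc, hqsqK, ← mul_assoc, hp.2]
  have hKT : ∀ k, K * T k = K - K * q k := fun k => by
    rw [hT, mul_sub, mul_one, ← mul_assoc, hKqsq, hKq, mul_assoc, hp.1]
  have hTK : ∀ k, T k * K = K - K * q k := fun k => by
    rw [hT, sub_mul, one_mul, mul_assoc, hp.2, hqsqK]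
  have hKU : Fixes K U := by
    constructor <;> ext x y
    · rw [← hZ x y (b x) (Or.inl rfl), ← hKR, hK, diagonal_mul, diagonal_mul, hU, of_apply]
    · rw [← hZ x y (b x) (Or.inl rfl), ← hRK, hUX]
  have hKL : Fixes K L := by
    constructor <;> ext x y
    · rw [← hZ x y (b y) (Or.inr rfl), ← hKT, hXL]
    · rw [← hZ x y (b y) (Or.inr rfl), ← hTK, hK, mul_diagonal, mul_diagonal, hL, of_apply]
  set D := U * M * L with hD
  have hDdet : IsUnit D.det := by
    rwa [hD, det_mul, det_mul, hUu.det_eq_one, hLl.det_eq_one, one_mul, mul_one]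
  have hDt : D.BlockTriangular b := fun x y hxy => by
    rw [hD, mul_assoc, hUu.mul_apply_of_le hML hxy.le, hML hxy]
  have hDt' : Dᵀ.BlockTriangular b := fun y x hxy => by
    rw [transpose_apply, hD, hLl.mul_apply_of_le hUM hxy.le]
    exact hUM hxy
  have hdiag : ∀ {X : Matrix m m S}, X.BlockTriangular b → Xᵀ.BlockTriangular b → BlockDiag b X :=
    fun h h' x y hxy => hxy.lt_or_gt.elim (fun hlt => h' hlt) fun hlt => h hlt
  have hKD : Fixes K D := (hKU.mul hp).mul hKL
  refine ⟨U⁻¹, D, D⁻¹, L⁻¹, hUu.inv, hdiag hDt hDt', hdiag ?_ ?_, hLl.inv,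
    mul_nonsing_inv _ hDdet, nonsing_inv_mul _ hDdet, ?_, hKU.of_inverse hUu.mul_inv hUu.inv_mul,
    hKD, hKL.of_inverse hLl.mul_inv hLl.inv_mul⟩
  · have := invertibleOfIsUnitDet D hDdet
    exact blockTriangular_inv_of_blockTriangular hDt
  · have := invertibleOfIsUnitDet Dᵀ (by rwa [det_transpose])
    rw [transpose_nonsing_inv]
    exact blockTriangular_inv_of_blockTriangular hDt'
  · calc U⁻¹ * D * L⁻¹ = (U⁻¹ * U) * M * (L * L⁻¹) := by rw [hD]; simp only [mul_assoc]
      _ = M := by rw [hUu.inv_mul, hLl.mul_inv, one_mul, mul_one]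

end UDL

section Representations

open Matrix

variable {𝕜} {n : ℕ} {Q : ColoredQuiver n} {d : Fin n → ℕ} {S : Type} [CommRing S] [Algebra 𝕜 S]

/-- The block idempotents of the matrix algebra. -/
def blockE (s : Fin n) : Matrix (Idx d) (Idx d) S := diagonal fun x => if x.1 = s then 1 else 0

theorem blockE_mul_mul_apply (i j : Fin n) (A : Matrix (Idx d) (Idx d) S) (x y : Idx d) :
    (blockE i * A * blockE j : Matrix (Idx d) (Idx d) S) x y =
      if x.1 = i ∧ y.1 = j then A x y else 0 := by
  rw [blockE, blockE, mul_diagonal, diagonal_mul]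
  split_ifs <;> simp_all

theorem blockE_mul_blockE (i j : Fin n) :
    blockE i * blockE j = if i = j then (blockE i : Matrix (Idx d) (Idx d) S) else 0 := by
  rw [blockE, blockE, diagonal_mul_diagonal]
  split_ifs with h
  · subst h
    congr 1
    ext x
    split_ifs <;> simp
  · rw [← diagonal_zero]
    congr 1
    ext x
    split_ifs <;> simp_all

theorem sum_blockE : ∑ s, blockE s = (1 : Matrix (Idx d) (Idx d) S) := by
  ext x y
  rw [Matrix.sum_apply]
  rcases eq_or_ne x y with rfl | h
  · simp [blockE]
  · simp [blockE, h]

/-- `A i j` is supported on the block `(i, j)`. -/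
def BlockSupported (A : Fin n → Fin n → Matrix (Idx d) (Idx d) S) : Prop :=
  ∀ i j, A i j = blockE i * A i j * blockE j

theorem BlockSupported.apply {A : Fin n → Fin n → Matrix (Idx d) (Idx d) S}
    (hA : BlockSupported A) (i j : Fin n) (x y : Idx d) :
    A i j x y = if x.1 = i ∧ y.1 = j then A x.1 y.1 x y else 0 := by
  rw [hA i j, blockE_mul_mul_apply]
  split_ifs with h
  · rw [h.1, h.2]
  · rfl

theorem BlockSupported.ext {A A' : Fin n → Fin n → Matrix (Idx d) (Idx d) S}
    (hA : BlockSupported A) (hA' : BlockSupported A')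
    (h : ∀ x y, A x.1 y.1 x y = A' x.1 y.1 x y) : A = A' := by
  ext i j x y
  rw [hA.apply, hA'.apply, h]

theorem BlockSupported.sum_apply {A : Fin n → Fin n → Matrix (Idx d) (Idx d) S}
    (hA : BlockSupported A) (s : Finset (Fin n × Fin n)) (x y : Idx d) :
    (∑ p ∈ s, A p.1 p.2) x y = if (x.1, y.1) ∈ s then A x.1 y.1 x y else 0 := by
  have : ∀ p ∈ s, A p.1 p.2 x y = if p = (x.1, y.1) then A x.1 y.1 x y else 0 := fun p _ => by
    rw [hA.apply]
    simp only [Prod.ext_iff, eq_comm]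
  rw [Matrix.sum_apply, Finset.sum_congr rfl this, Finset.sum_ite_eq']

/-- The block upper unitriangular matrix with prescribed blocks above the diagonal. -/
def upperOf (A : Fin n → Fin n → Matrix (Idx d) (Idx d) S) : Matrix (Idx d) (Idx d) S :=
  Matrix.of fun x y => if x.1 < y.1 then A x.1 y.1 x y else (1 : Matrix (Idx d) (Idx d) S) x y

/-- The block lower unitriangular matrix with prescribed blocks below the diagonal. -/
def lowerOf (A : Fin n → Fin n → Matrix (Idx d) (Idx d) S) : Matrix (Idx d) (Idx d) S :=
  Matrix.of fun x y => if y.1 < x.1 then A x.1 y.1 x y else (1 : Matrix (Idx d) (Idx d) S) x y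

theorem upperUni_upperOf (A : Fin n → Fin n → Matrix (Idx d) (Idx d) S) :
    UpperUni Sigma.fst (upperOf A) := fun _ _ hxy => if_neg hxy.not_gt

theorem lowerUni_lowerOf (A : Fin n → Fin n → Matrix (Idx d) (Idx d) S) :
    LowerUni Sigma.fst (lowerOf A) := fun _ _ hxy => if_neg hxy.not_gt

variable (Q) in
/-- The projection onto the blocks outside of `I_c`. -/
def outside (c : Q.C) : Matrix (Idx d) (Idx d) S :=
  diagonal fun x => if x.1 ∉ Q.mem c then 1 else 0

theorem outside_mul_outside (c : Q.C) :
    outside Q c * outside Q c = (outside Q c : Matrix (Idx d) (Idx d) S) := by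
  rw [outside, diagonal_mul_diagonal]
  congr 1
  ext x
  split_ifs <;> simp

theorem fixes_outside_iff (c : Q.C) (A : Matrix (Idx d) (Idx d) S) :
    Fixes (outside Q c) A ↔
      ∀ x y, (x.1 ∉ Q.mem c ∨ y.1 ∉ Q.mem c) → A x y = (1 : Matrix (Idx d) (Idx d) S) x y := by
  have hK : ∀ x y : Idx d, (outside Q c : Matrix (Idx d) (Idx d) S) x y
      = (if x.1 ∉ Q.mem c then 1 else 0) * (1 : Matrix (Idx d) (Idx d) S) x y := fun x y => by
    rw [outside, diagonal_apply, one_apply]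
    split_ifs <;> simp
  have hK' : ∀ x y : Idx d, (outside Q c : Matrix (Idx d) (Idx d) S) x y
      = (1 : Matrix (Idx d) (Idx d) S) x y * (if y.1 ∉ Q.mem c then 1 else 0) := fun x y => by
    rw [outside, diagonal_apply, one_apply]
    split_ifs <;> simp_all
  constructor
  · rintro ⟨h1, h2⟩ x y (h | h)
    · have := congrFun (congrFun h1 x) y
      rwa [hK, outside, diagonal_mul, if_pos h, one_mul, one_mul] at this
    · have := congrFun (congrFun h2 x) y
      rwa [hK', outside, mul_diagonal, if_pos h, mul_one, mul_one] at this
  · intro h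
    constructor <;> ext x y
    · rw [hK, outside, diagonal_mul]
      split_ifs with hx
      · simp
      · rw [h x y (Or.inl hx)]
    · rw [hK', outside, mul_diagonal]
      split_ifs with hy
      · simp
      · rw [h x y (Or.inr hy)]

/-- `A i j` vanishes unless `i` and `j` are distinct vertices in `I_c`. -/
def VanishesOff (c : Q.C) (A : Fin n → Fin n → Matrix (Idx d) (Idx d) S) : Prop :=
  ∀ i j, ¬ (i ≠ j ∧ i ∈ Q.mem c ∧ j ∈ Q.mem c) → A i j = 0

theorem VanishesOff.fixes_upperOf {c : Q.C} {A : Fin n → Fin n → Matrix (Idx d) (Idx d) S}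
    (hA : VanishesOff c A) : Fixes (outside Q c) (upperOf A) := by
  rw [fixes_outside_iff]
  intro x y h
  rw [upperOf, of_apply]
  split_ifs with hlt
  · rw [hA _ _ (by tauto), one_apply_ne (by rintro rfl; exact lt_irrefl _ hlt), Matrix.zero_apply]
  · rfl

theorem VanishesOff.fixes_lowerOf {c : Q.C} {A : Fin n → Fin n → Matrix (Idx d) (Idx d) S}
    (hA : VanishesOff c A) : Fixes (outside Q c) (lowerOf A) := by
  rw [fixes_outside_iff]
  intro x y h
  rw [lowerOf, of_apply]
  split_ifs with hlt
  · rw [hA _ _ (by tauto), one_apply_ne (by rintro rfl; exact lt_irrefl _ hlt), Matrix.zero_apply]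
  · rfl

variable (Φ : FreeAlgebra 𝕜 (BGen n Q.C) →ₐ[𝕜] Matrix (Idx d) (Idx d) S)

theorem map_oneIc (hE : ∀ s, Φ (bfE 𝕜 Q s) = blockE s) (c : Q.C) :
    Φ (oneIc 𝕜 Q c) = 1 - outside Q c := by
  rw [oneIc, map_sum, ← diagonal_one, outside, diagonal_sub, Finset.sum_congr rfl fun s _ => hE s]
  ext x y
  rw [Matrix.sum_apply, diagonal_apply]
  rcases eq_or_ne x y with rfl | h
  · simp [blockE]
    split_ifs <;> simp
  · simp [blockE, h]

theorem oneIc_add_upper (hE : ∀ s, Φ (bfE 𝕜 Q s) = blockE s) (c : Q.C)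
    (g : Fin n → Fin n → FreeAlgebra 𝕜 (BGen n Q.C))
    (hg : BlockSupported fun i j => Φ (g i j)) :
    Φ (oneIc 𝕜 Q c + ∑ p ∈ Finset.univ.filter (fun p : Fin n × Fin n => p.1 < p.2),
      g p.1 p.2) = upperOf (fun i j => Φ (g i j)) - outside Q c := by
  rw [map_add, map_oneIc Φ hE, map_sum, sub_add_eq_add_sub]
  congr 1
  ext x y
  rw [Matrix.add_apply, hg.sum_apply, upperOf, of_apply]
  simp only [Finset.mem_filter, Finset.mem_univ, true_and]
  split_ifs with h
  · rw [one_apply_ne (by rintro rfl; exact lt_irrefl _ h), zero_add]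
  · rw [add_zero]

theorem oneIc_add_lower (hE : ∀ s, Φ (bfE 𝕜 Q s) = blockE s) (c : Q.C)
    (g : Fin n → Fin n → FreeAlgebra 𝕜 (BGen n Q.C))
    (hg : BlockSupported fun i j => Φ (g i j)) :
    Φ (oneIc 𝕜 Q c + ∑ p ∈ Finset.univ.filter (fun p : Fin n × Fin n => p.2 < p.1),
      g p.1 p.2) = lowerOf (fun i j => Φ (g i j)) - outside Q c := by
  rw [map_add, map_oneIc Φ hE, map_sum, sub_add_eq_add_sub]
  congr 1
  ext x y
  rw [Matrix.add_apply, hg.sum_apply, lowerOf, of_apply]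
  simp only [Finset.mem_filter, Finset.mem_univ, true_and]
  split_ifs with h
  · rw [one_apply_ne (by rintro rfl; exact lt_irrefl _ h), zero_add]
  · rw [add_zero]

/-- An algebra homomorphism from the free algebra that satisfies the relations of the Boalch
algebra and is compatible with the block structure. -/
structure IsRep : Prop where
  idem : ∀ s, Φ (bfE 𝕜 Q s) = blockE s
  rel : ∀ a b, BoalchRel 𝕜 Q a b → Φ a = Φ b

namespace IsRep

variable {Φ}

theorem vanishesOff_W (h : IsRep Φ) (c : Q.C) : VanishesOff c fun i j => Φ (bfW 𝕜 Q c i j) := fun i j hij =>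
  (h.rel _ _ (.wzero c i j hij)).trans (map_zero Φ)

theorem vanishesOff_V (h : IsRep Φ) (c : Q.C) : VanishesOff c fun i j => Φ (bfV 𝕜 Q c i j) := fun i j hij =>
  (h.rel _ _ (.vzero c i j fun hd => hij ⟨hd.1, hd.2.1, hd.2.2.1⟩)).trans (map_zero Φ)

theorem blockSupported_W (h : IsRep Φ) (c : Q.C) : BlockSupported fun i j => Φ (bfW 𝕜 Q c i j) := fun i j => by
  by_cases hij : i ≠ j ∧ i ∈ Q.mem c ∧ j ∈ Q.mem c
  · exact (h.rel _ _ (.wsupp c i j hij)).trans (by rw [map_mul, map_mul, h.idem, h.idem])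
  · simp only [h.vanishesOff_W c i j hij, mul_zero, zero_mul]

theorem blockSupported_V (h : IsRep Φ) (c : Q.C) : BlockSupported fun i j => Φ (bfV 𝕜 Q c i j) := fun i j => by
  by_cases hij : Q.DArr c i j
  · exact (h.rel _ _ (.vsupp c i j hij)).trans (by rw [map_mul, map_mul, h.idem, h.idem])
  · simp only [(h.rel _ _ (.vzero c i j hij)).trans (map_zero Φ), mul_zero, zero_mul]

theorem map_G (h : IsRep Φ) (c : Q.C) (i : Fin n) :
    Φ (bfG 𝕜 Q c i) = blockE i * Φ (bfG 𝕜 Q c i) * blockE i := by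
  by_cases hi : i ∈ Q.mem c
  · exact (h.rel _ _ (.gsupp c i hi)).trans (by rw [map_mul, map_mul, h.idem])
  · simp only [(h.rel _ _ (.gzero c i hi)).trans (map_zero Φ), mul_zero, zero_mul]

theorem map_Gi (h : IsRep Φ) (c : Q.C) (i : Fin n) :
    Φ (bfGi 𝕜 Q c i) = blockE i * Φ (bfGi 𝕜 Q c i) * blockE i := by
  by_cases hi : i ∈ Q.mem c
  · exact (h.rel _ _ (.gisupp c i hi)).trans (by rw [map_mul, map_mul, h.idem])
  · simp only [(h.rel _ _ (.gizero c i hi)).trans (map_zero Φ), mul_zero, zero_mul]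

end IsRep

/-- The sum over `I_c` of a family of block diagonal matrices, completed by the identity. -/
def diagOf (c : Q.C) (A : Fin n → Matrix (Idx d) (Idx d) S) : Matrix (Idx d) (Idx d) S :=
  ∑ i ∈ Q.mem c, A i + outside Q c

theorem diagOf_sub (c : Q.C) (A : Fin n → Matrix (Idx d) (Idx d) S) :
    diagOf c A - outside Q c = ∑ i ∈ Q.mem c, A i := add_sub_cancel_right _ _

theorem blockE_mul_outside {c : Q.C} {i : Fin n} (hi : i ∈ Q.mem c) :
    blockE i * outside Q c = (0 : Matrix (Idx d) (Idx d) S) := by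
  rw [blockE, outside, diagonal_mul_diagonal, ← diagonal_zero]
  congr 1
  ext x
  split_ifs <;> simp_all

theorem outside_mul_blockE {c : Q.C} {i : Fin n} (hi : i ∈ Q.mem c) :
    outside Q c * blockE i = (0 : Matrix (Idx d) (Idx d) S) := by
  rw [blockE, outside, diagonal_mul_diagonal, ← diagonal_zero]
  congr 1
  ext x
  split_ifs <;> simp_all

theorem fixes_diagOf (c : Q.C) {A : Fin n → Matrix (Idx d) (Idx d) S}
    (hA : ∀ i, A i = blockE i * A i * blockE i) : Fixes (outside Q c) (diagOf c A) := by
  refine fixes_add (outside_mul_outside c) ?_ ?_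
  · rw [Finset.mul_sum]
    refine Finset.sum_eq_zero fun i hi => ?_
    rw [hA, ← mul_assoc, ← mul_assoc, outside_mul_blockE hi, zero_mul, zero_mul]
  · rw [Finset.sum_mul]
    refine Finset.sum_eq_zero fun i hi => ?_
    rw [hA, mul_assoc, blockE_mul_outside hi, mul_zero]

theorem blockDiag_diagOf (c : Q.C) {A : Fin n → Matrix (Idx d) (Idx d) S}
    (hA : ∀ i, A i = blockE i * A i * blockE i) : BlockDiag Sigma.fst (diagOf c A) := by
  intro x y hxy
  rw [diagOf, Matrix.add_apply, Matrix.sum_apply, outside, diagonal_apply_ne _ (by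
    rintro rfl; exact hxy rfl), add_zero]
  refine Finset.sum_eq_zero fun i _ => ?_
  rw [hA, blockE_mul_mul_apply, if_neg]
  rintro ⟨rfl, h⟩
  exact hxy h.symm

theorem blockE_mul_diagOf_mul_blockE {c : Q.C} {i : Fin n} (hi : i ∈ Q.mem c)
    {A : Fin n → Matrix (Idx d) (Idx d) S} (hA : ∀ i, A i = blockE i * A i * blockE i) :
    blockE i * diagOf c A * blockE i = A i := by
  rw [diagOf, mul_add, blockE_mul_outside hi, add_zero, Finset.mul_sum, Finset.sum_mul,
    Finset.sum_eq_single_of_mem i hi, ← hA]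
  intro j _ hj
  rw [hA j, ← mul_assoc, ← mul_assoc, blockE_mul_blockE, if_neg hj.symm]
  simp

theorem diagOf_mul_diagOf (c : Q.C) {A A' : Fin n → Matrix (Idx d) (Idx d) S}
    (hA : ∀ i, A i = blockE i * A i * blockE i) (hA' : ∀ i, A' i = blockE i * A' i * blockE i)
    (hAA : ∀ i ∈ Q.mem c, A i * A' i = blockE i) : diagOf c A * diagOf c A' = 1 := by
  have h0 : ∀ i j, i ≠ j → A i * A' j = 0 := fun i j hij => by
    rw [hA i, hA' j]
    calc blockE i * A i * blockE i * (blockE j * A' j * blockE j)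
        = blockE i * A i * (blockE i * blockE j) * A' j * blockE j := by simp only [mul_assoc]
      _ = 0 := by rw [blockE_mul_blockE, if_neg hij]; simp
  have h1 : ∑ i ∈ Q.mem c, (blockE i : Matrix (Idx d) (Idx d) S) = 1 - outside Q c := by
    ext x y
    rw [Matrix.sum_apply, Matrix.sub_apply]
    rcases eq_or_ne x y with rfl | h
    · simp [blockE, outside]
      split_ifs <;> simp
    · simp [blockE, outside, h]
  have := (fixes_diagOf c hA).sub_mul_sub (fixes_diagOf c hA') (outside_mul_outside c)
  rw [diagOf_sub, diagOf_sub, Finset.sum_mul_sum] at this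
  rw [← sub_left_inj (a := outside Q c), ← this, ← h1]
  refine Finset.sum_congr rfl fun i hi => ?_
  rw [Finset.sum_eq_single_of_mem i hi fun j _ hj => h0 i j hj.symm, hAA i hi]

theorem main_relation_iff (c : Q.C) (hE : ∀ s, Φ (bfE 𝕜 Q s) = blockE s)
    (hV : BlockSupported fun i j => Φ (bfV 𝕜 Q c i j))
    (hV' : VanishesOff c fun i j => Φ (bfV 𝕜 Q c i j))
    (hW : BlockSupported fun i j => Φ (bfW 𝕜 Q c i j))
    (hW' : VanishesOff c fun i j => Φ (bfW 𝕜 Q c i j))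
    (hG : ∀ i, Φ (bfG 𝕜 Q c i) = blockE i * Φ (bfG 𝕜 Q c i) * blockE i) :
    Φ (vcMinus 𝕜 Q c * vcPlus 𝕜 Q c) = Φ (wcPlus 𝕜 Q c * gamC 𝕜 Q c * wcMinus 𝕜 Q c) ↔
      upperOf (fun i j => Φ (bfW 𝕜 Q c i j)) * diagOf c (fun i => Φ (bfG 𝕜 Q c i)) *
          lowerOf (fun i j => Φ (bfW 𝕜 Q c i j)) =
        lowerOf (fun i j => Φ (bfV 𝕜 Q c i j)) * upperOf (fun i j => Φ (bfV 𝕜 Q c i j)) := by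
  have hK := outside_mul_outside (S := S) (d := d) c
  rw [map_mul, map_mul, map_mul, vcMinus, vcPlus, wcPlus, wcMinus, gamC, map_sum,
    oneIc_add_upper Φ hE c _ hV, oneIc_add_lower Φ hE c _ hV, oneIc_add_upper Φ hE c _ hW,
    oneIc_add_lower Φ hE c _ hW, ← diagOf_sub, hV'.fixes_lowerOf.sub_mul_sub hV'.fixes_upperOf hK,
    hW'.fixes_upperOf.sub_mul_sub (fixes_diagOf c hG) hK,
    (hW'.fixes_upperOf.mul (fixes_diagOf c hG)).sub_mul_sub hW'.fixes_lowerOf hK, sub_left_inj,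
    eq_comm]

theorem IsRep.udl (h : IsRep Φ) (c : Q.C) :
    upperOf (fun i j => Φ (bfW 𝕜 Q c i j)) * diagOf c (fun i => Φ (bfG 𝕜 Q c i)) *
        lowerOf (fun i j => Φ (bfW 𝕜 Q c i j)) =
      lowerOf (fun i j => Φ (bfV 𝕜 Q c i j)) * upperOf (fun i j => Φ (bfV 𝕜 Q c i j)) :=
  (main_relation_iff Φ c h.idem (h.blockSupported_V c) (h.vanishesOff_V c) (h.blockSupported_W c)
    (h.vanishesOff_W c) (h.map_G c)).1 (h.rel _ _ (.main c))

variable {Φ}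

theorem IsRep.G_mul_Gi (h : IsRep Φ) {c : Q.C} {i : Fin n} (hi : i ∈ Q.mem c) :
    Φ (bfG 𝕜 Q c i) * Φ (bfGi 𝕜 Q c i) = blockE i := by
  rw [← map_mul, h.rel _ _ (.ginv c i hi), h.idem]

theorem IsRep.Gi_mul_G (h : IsRep Φ) {c : Q.C} {i : Fin n} (hi : i ∈ Q.mem c) :
    Φ (bfGi 𝕜 Q c i) * Φ (bfG 𝕜 Q c i) = blockE i := by
  rw [← map_mul, h.rel _ _ (.ginv' c i hi), h.idem]

/-- A representation is determined by the matrices of the arrows of the double `Ῡ`. -/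
theorem IsRep.ext {Ψ : FreeAlgebra 𝕜 (BGen n Q.C) →ₐ[𝕜] Matrix (Idx d) (Idx d) S}
    (h : IsRep Φ) (h' : IsRep Ψ)
    (hV : ∀ c i j, Φ (bfV 𝕜 Q c i j) = Ψ (bfV 𝕜 Q c i j)) : Φ = Ψ := by
  have key : ∀ c, _ := fun c => udl_unique (upperUni_upperOf _) (blockDiag_diagOf c (h.map_G c))
    (lowerUni_lowerOf _) (upperUni_upperOf _) (blockDiag_diagOf c (h'.map_G c))
    (lowerUni_lowerOf _) (IsUnit.of_mul_eq_one _ (diagOf_mul_diagOf c (h.map_G c) (h.map_Gi c)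
      fun i hi => h.G_mul_Gi hi)) (by rw [IsRep.udl Φ h, IsRep.udl Ψ h']; simp only [hV])
  have hW : ∀ c i j, Φ (bfW 𝕜 Q c i j) = Ψ (bfW 𝕜 Q c i j) := fun c i j => by
    refine congrFun (congrFun ((h.blockSupported_W c).ext (h'.blockSupported_W c) ?_) i) j
    intro x y
    rcases lt_trichotomy x.1 y.1 with hxy | hxy | hxy
    · have := congrFun (congrFun (key c).1 x) y
      simpa only [upperOf, of_apply, if_pos hxy] using this
    · have h1 := h.vanishesOff_W c x.1 y.1 (by tauto)
      have h2 := h'.vanishesOff_W c x.1 y.1 (by tauto)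
      simp only at h1 h2
      rw [h1, h2]
    · have := congrFun (congrFun (key c).2.2 x) y
      simpa only [lowerOf, of_apply, if_pos hxy] using this
  have hG : ∀ c i, Φ (bfG 𝕜 Q c i) = Ψ (bfG 𝕜 Q c i) := fun c i => by
    by_cases hi : i ∈ Q.mem c
    · have := congrArg (fun D => blockE i * D * blockE i) (key c).2.1
      simpa only [blockE_mul_diagOf_mul_blockE hi (h.map_G c),
        blockE_mul_diagOf_mul_blockE hi (h'.map_G c)] using this
    · rw [h.rel _ _ (.gzero c i hi), h'.rel _ _ (.gzero c i hi), map_zero, map_zero]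
  have hGi : ∀ c i, Φ (bfGi 𝕜 Q c i) = Ψ (bfGi 𝕜 Q c i) := fun c i => by
    by_cases hi : i ∈ Q.mem c
    · have hl : blockE i * Ψ (bfGi 𝕜 Q c i) = Ψ (bfGi 𝕜 Q c i) := by
        rw [h'.map_Gi, ← mul_assoc, ← mul_assoc, blockE_mul_blockE, if_pos rfl]
      have hr : Φ (bfGi 𝕜 Q c i) * blockE i = Φ (bfGi 𝕜 Q c i) := by
        rw [h.map_Gi, mul_assoc, blockE_mul_blockE, if_pos rfl]
      rw [← hr, ← h'.G_mul_Gi hi, ← hG, ← mul_assoc, h.Gi_mul_G hi, hl]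
    · rw [h.rel _ _ (.gizero c i hi), h'.rel _ _ (.gizero c i hi), map_zero, map_zero]
  refine FreeAlgebra.hom_ext (funext fun g => ?_)
  cases g with
  | E s => exact (h.idem s).trans (h'.idem s).symm
  | V c i j => exact hV c i j
  | W c i j => exact hW c i j
  | G c i => exact hG c i
  | Gi c i => exact hGi c i

/-- The matrices of the arrows of the double `Ῡ` with prescribed entries. -/
def arrowMat (x : Q.C → Idx d → Idx d → S) (c : Q.C) (i j : Fin n) : Matrix (Idx d) (Idx d) S :=
  Matrix.of fun a b => if a.1 = i ∧ b.1 = j ∧ Q.DArr c i j then x c a b else 0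

theorem blockSupported_arrowMat (x : Q.C → Idx d → Idx d → S) (c : Q.C) :
    BlockSupported (arrowMat x c) := fun i j => by
  ext a b
  rw [blockE_mul_mul_apply, arrowMat, of_apply]
  split_ifs <;> first | rfl | tauto

theorem arrowMat_eq_zero (x : Q.C → Idx d → Idx d → S) {c : Q.C} {i j : Fin n}
    (h : ¬ Q.DArr c i j) : arrowMat x c i j = 0 := by
  ext a b
  rw [arrowMat, of_apply, if_neg (by tauto), Matrix.zero_apply]

theorem vanishesOff_arrowMat (x : Q.C → Idx d → Idx d → S) (c : Q.C) :
    VanishesOff c (arrowMat x c) := fun _ _ h =>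
  arrowMat_eq_zero x fun hd => h ⟨hd.1, hd.2.1, hd.2.2.1⟩

/-- The function cutting out, as a principal open subset of the space of representations of the
double `Ῡ`, the locus of those representations that extend to the Boalch algebra. -/
def disc (x : Q.C → Idx d → Idx d → S) : S :=
  ∏ c, minorProd Sigma.fst (lowerOf (arrowMat x c) * upperOf (arrowMat x c))

theorem IsRep.isUnit_disc (h : IsRep Φ) {x : Q.C → Idx d → Idx d → S}
    (hx : ∀ c i j, Φ (bfV 𝕜 Q c i j) = arrowMat x c i j) : IsUnit (disc x) := by
  refine IsUnit.prod_univ_iff.2 fun c => ?_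
  have := IsRep.udl Φ h c
  simp only [hx] at this
  change _ = lowerOf (arrowMat x c) * upperOf (arrowMat x c) at this
  rw [← this]
  exact isUnit_minorProd (upperUni_upperOf _) (blockDiag_diagOf c (h.map_G c))
    (lowerUni_lowerOf _) (diagOf_mul_diagOf c (h.map_G c) (h.map_Gi c) fun i hi => h.G_mul_Gi hi)

end Representations

section Existence

open Matrix

variable {𝕜} {n : ℕ} {Q : ColoredQuiver n} {d : Fin n → ℕ} {S : Type} [CommRing S] [Algebra 𝕜 S]

/-- Every point of the principal open subset defined by `disc` comes from a representation of the
Boalch algebra. -/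
theorem exists_isRep {x : Q.C → Idx d → Idx d → S} (hx : IsUnit (disc x)) :
    ∃ Φ : FreeAlgebra 𝕜 (BGen n Q.C) →ₐ[𝕜] Matrix (Idx d) (Idx d) S,
      IsRep Φ ∧ ∀ c i j, Φ (bfV 𝕜 Q c i j) = arrowMat x c i j := by
  choose U D D' L hU hD hD' hL hDD' hD'D hUDL hKU hKD hKL using fun c : Q.C =>
    exists_udl (p := fun i => i ∉ Q.mem c) (IsUnit.prod_univ_iff.1 hx c)
      ((vanishesOff_arrowMat x c).fixes_lowerOf.mul (vanishesOff_arrowMat x c).fixes_upperOf)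
  let w : Q.C → Fin n → Fin n → Matrix (Idx d) (Idx d) S := fun c i j =>
    if i < j then blockE i * U c * blockE j
    else if j < i then blockE i * L c * blockE j else 0
  let g : Q.C → Fin n → Matrix (Idx d) (Idx d) S := fun c i =>
    if i ∈ Q.mem c then blockE i * D c * blockE i else 0
  let g' : Q.C → Fin n → Matrix (Idx d) (Idx d) S := fun c i =>
    if i ∈ Q.mem c then blockE i * D' c * blockE i else 0
  let Φ : FreeAlgebra 𝕜 (BGen n Q.C) →ₐ[𝕜] Matrix (Idx d) (Idx d) S :=
    FreeAlgebra.lift 𝕜 fun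
      | .E s => blockE s
      | .V c i j => arrowMat x c i j
      | .W c i j => w c i j
      | .G c i => g c i
      | .Gi c i => g' c i
  have hE : ∀ s, Φ (bfE 𝕜 Q s) = blockE s := fun s => FreeAlgebra.lift_ι_apply _ _
  have hV : ∀ c i j, Φ (bfV 𝕜 Q c i j) = arrowMat x c i j := fun c i j =>
    FreeAlgebra.lift_ι_apply _ _
  have hW : ∀ c i j, Φ (bfW 𝕜 Q c i j) = w c i j := fun c i j => FreeAlgebra.lift_ι_apply _ _
  have hG : ∀ c i, Φ (bfG 𝕜 Q c i) = g c i := fun c i => FreeAlgebra.lift_ι_apply _ _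
  have hGi : ∀ c i, Φ (bfGi 𝕜 Q c i) = g' c i := fun c i => FreeAlgebra.lift_ι_apply _ _
  have hEE : ∀ (A : Matrix (Idx d) (Idx d) S) (i j : Fin n),
      blockE i * (blockE i * A * blockE j) * blockE j = blockE i * A * blockE j := fun A i j => by
    ext a b
    rw [blockE_mul_mul_apply, blockE_mul_mul_apply]
    split_ifs <;> rfl
  have hws : ∀ c, BlockSupported (w c) := fun c i j => by
    simp only [w]
    split_ifs
    · exact (hEE _ _ _).symm
    · exact (hEE _ _ _).symm
    · simp
  have hwz : ∀ c, VanishesOff c (w c) := fun c i j hij => by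
    have hz : ∀ A : Matrix (Idx d) (Idx d) S, Fixes (outside Q c) A → i ≠ j →
        blockE i * A * blockE j = 0 := fun A hA hne => by
      ext a b
      rw [blockE_mul_mul_apply, Matrix.zero_apply]
      split_ifs with hab
      · rw [(fixes_outside_iff c A).1 hA a b (by rw [hab.1, hab.2]; tauto), one_apply_ne]
        rintro rfl
        exact hne (hab.1.symm.trans hab.2)
      · rfl
    simp only [w]
    split_ifs with h1 h2
    · exact hz _ (hKU c) h1.ne
    · exact hz _ (hKL c) h2.ne'
    · rfl
  have hwU : ∀ c, upperOf (w c) = U c := fun c => by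
    ext a b
    rw [upperOf, of_apply]
    split_ifs with hab
    · simp only [w, if_pos hab]
      rw [blockE_mul_mul_apply, if_pos ⟨rfl, rfl⟩]
    · exact (hU c a b (not_lt.1 hab)).symm
  have hwL : ∀ c, lowerOf (w c) = L c := fun c => by
    ext a b
    rw [lowerOf, of_apply]
    split_ifs with hab
    · simp only [w, if_neg hab.not_gt, if_pos hab]
      rw [blockE_mul_mul_apply, if_pos ⟨rfl, rfl⟩]
    · exact (hL c a b (not_lt.1 hab)).symm
  have hgs : ∀ c i, g c i = blockE i * g c i * blockE i := fun c i => by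
    simp only [g]
    split_ifs
    · exact (hEE _ _ _).symm
    · simp
  have hgs' : ∀ c i, g' c i = blockE i * g' c i * blockE i := fun c i => by
    simp only [g']
    split_ifs
    · exact (hEE _ _ _).symm
    · simp
  have hgD : ∀ c, diagOf c (g c) = D c := fun c => by
    ext a b
    by_cases hab : a.1 = b.1
    · by_cases ha : a.1 ∈ Q.mem c
      · have h1 := congrFun (congrFun (blockE_mul_diagOf_mul_blockE ha (hgs c)) a) b
        rw [blockE_mul_mul_apply, if_pos ⟨rfl, hab.symm⟩] at h1
        simp only [g, if_pos ha] at h1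
        rwa [blockE_mul_mul_apply, if_pos ⟨rfl, hab.symm⟩] at h1
      · rw [(fixes_outside_iff c _).1 (fixes_diagOf c (hgs c)) a b (Or.inl ha),
          (fixes_outside_iff c _).1 (hKD c) a b (Or.inl ha)]
    · rw [blockDiag_diagOf c (hgs c) a b hab, hD c a b hab]
  have hcomm : ∀ (A : Matrix (Idx d) (Idx d) S), BlockDiag Sigma.fst A → ∀ i,
      A * blockE i = blockE i * A := fun A hA i => by
    ext a b
    rw [blockE, mul_diagonal, diagonal_mul]
    by_cases hab : a.1 = b.1
    · rw [hab, mul_comm]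
    · rw [hA a b hab]
      simp
  have hprod : ∀ (A B : Matrix (Idx d) (Idx d) S), BlockDiag Sigma.fst A → A * B = 1 → ∀ i,
      blockE i * A * blockE i * (blockE i * B * blockE i) = blockE i := fun A B hA hAB i => by
    have hee : (blockE i : Matrix (Idx d) (Idx d) S) * blockE i = blockE i := by
      rw [blockE_mul_blockE, if_pos rfl]
    calc blockE i * A * blockE i * (blockE i * B * blockE i)
        = blockE i * (A * (blockE i * blockE i)) * B * blockE i := by simp only [mul_assoc]
      _ = blockE i * (A * B) * blockE i := by
          rw [hee, hcomm A hA, ← mul_assoc, hee, mul_assoc (blockE i) A B]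
      _ = blockE i := by rw [hAB, mul_one, hee]
  refine ⟨Φ, ⟨hE, fun a b hab => ?_⟩, hV⟩
  cases hab with
  | orth i j =>
    rw [map_mul, hE, hE, blockE_mul_blockE]
    split_ifs
    · rw [hE]
    · rw [map_zero]
  | sum_one => rw [map_sum, map_one, Finset.sum_congr rfl fun s _ => hE s, sum_blockE]
  | vsupp c i j _ => rw [map_mul, map_mul, hE, hE, hV, ← blockSupported_arrowMat x c i j]
  | vzero c i j h => rw [hV, map_zero, arrowMat_eq_zero x h]
  | wsupp c i j _ => rw [map_mul, map_mul, hE, hE, hW, ← hws c i j]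
  | wzero c i j h => rw [hW, map_zero, hwz c i j h]
  | gsupp c i _ => rw [map_mul, map_mul, hE, hG, ← hgs c i]
  | gzero c i h => rw [hG, map_zero]; exact if_neg h
  | gisupp c i _ => rw [map_mul, map_mul, hE, hGi, ← hgs' c i]
  | gizero c i h => rw [hGi, map_zero]; exact if_neg h
  | ginv c i h =>
    rw [map_mul, hG, hGi, hE]
    simp only [g, g', if_pos h]
    exact hprod _ _ (hD c) (hDD' c) i
  | ginv' c i h =>
    rw [map_mul, hG, hGi, hE]
    simp only [g, g', if_pos h]
    exact hprod _ _ (hD' c) (hD'D c) i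
  | main c =>
    have eV : (fun i j => Φ (bfV 𝕜 Q c i j)) = arrowMat x c := funext₂ (hV c)
    have eW : (fun i j => Φ (bfW 𝕜 Q c i j)) = w c := funext₂ (hW c)
    have eG : (fun i => Φ (bfG 𝕜 Q c i)) = g c := funext (hG c)
    refine (main_relation_iff Φ c hE ?_ ?_ ?_ ?_ ?_).2 ?_
    · rw [eV]; exact blockSupported_arrowMat x c
    · rw [eV]; exact vanishesOff_arrowMat x c
    · rw [eW]; exact hws c
    · rw [eW]; exact hwz c
    · intro i; rw [hG]; exact hgs c i
    · rw [eV, eW, eG, hwU, hwL, hgD, hUDL]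

theorem disc_map {S' : Type} [CommRing S'] (f : S →+* S') (x : Q.C → Idx d → Idx d → S) :
    f (disc x) = disc fun c a b => f (x c a b) := by
  have hone : ∀ a b : Idx d, f ((1 : Matrix (Idx d) (Idx d) S) a b) = (1 : Matrix _ _ S') a b :=
    fun a b => by rw [one_apply, one_apply]; split_ifs <;> simp
  have harr : ∀ c i j a b, f (arrowMat x c i j a b)
      = arrowMat (fun c a b => f (x c a b)) c i j a b := fun c i j a b => by
    rw [arrowMat, arrowMat, of_apply, of_apply]; split_ifs <;> simp
  have hup : ∀ c, f.mapMatrix (upperOf (arrowMat x c))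
      = upperOf (arrowMat (fun c a b => f (x c a b)) c) := fun c => by
    ext a b
    rw [RingHom.mapMatrix_apply, map_apply, upperOf, upperOf, of_apply, of_apply]
    split_ifs
    · exact harr _ _ _ _ _
    · exact hone _ _
  have hlo : ∀ c, f.mapMatrix (lowerOf (arrowMat x c))
      = lowerOf (arrowMat (fun c a b => f (x c a b)) c) := fun c => by
    ext a b
    rw [RingHom.mapMatrix_apply, map_apply, lowerOf, lowerOf, of_apply, of_apply]
    split_ifs
    · exact harr _ _ _ _ _
    · exact hone _ _
  have hab : ∀ k : Fin n, f.mapMatrix (above Sigma.fst k : Matrix (Idx d) (Idx d) S)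
      = above Sigma.fst k := fun k => by
    rw [above, above, RingHom.mapMatrix_apply, diagonal_map (map_zero f)]
    congr 1
    ext a
    split_ifs <;> simp
  rw [disc, disc, map_prod]
  refine Finset.prod_congr rfl fun c _ => ?_
  rw [minorProd, minorProd, map_mul, map_prod, RingHom.map_det, map_mul, hup, hlo]
  congr 1
  refine Finset.prod_congr rfl fun k _ => ?_
  rw [RingHom.map_det, compress, compress, map_add, map_sub, map_mul, map_mul, map_mul, map_one,
    hup, hlo, hab]

theorem disc_zero : disc (fun _ _ _ => 0 : Q.C → Idx d → Idx d → S) = 1 := by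
  have hz : ∀ c i j, arrowMat (fun _ _ _ => 0 : Q.C → Idx d → Idx d → S) c i j = 0 :=
    fun c i j => by ext a b; simp [arrowMat]
  have hup : ∀ c, upperOf (arrowMat (fun _ _ _ => 0 : Q.C → Idx d → Idx d → S) c) = 1 :=
    fun c => by
      ext a b
      rw [upperOf, of_apply]
      split_ifs with hab
      · rw [hz, Matrix.zero_apply, one_apply_ne (by rintro rfl; exact lt_irrefl _ hab)]
      · rfl
  have hlo : ∀ c, lowerOf (arrowMat (fun _ _ _ => 0 : Q.C → Idx d → Idx d → S) c) = 1 :=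
    fun c => by
      ext a b
      rw [lowerOf, of_apply]
      split_ifs with hab
      · rw [hz, Matrix.zero_apply, one_apply_ne (by rintro rfl; exact lt_irrefl _ hab)]
      · rfl
  refine Finset.prod_eq_one fun c _ => ?_
  rw [hup, hlo, mul_one, minorProd, det_one, one_mul]
  refine Finset.prod_eq_one fun k _ => ?_
  rw [compress, mul_one, above_mul_above, sub_add_cancel, det_one]

end Existence

section Universal

open Matrix

variable {𝕜} {n : ℕ} {A : Type} [Ring A] [Algebra 𝕜 A] {ee : Fin n → A} {d : Fin n → ℕ}

variable (𝕜 ee d) in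
/-- The universal representation of `A`. -/
noncomputable def univMat (a : A) : Matrix (Idx d) (Idx d) (RepAlg 𝕜 A ee d) :=
  Matrix.of fun i j => Ideal.Quotient.mk _ (MvPolynomial.X (a, i, j))

theorem mk_eq_mk_of_sub {P P' : MvPolynomial (A × Idx d × Idx d) 𝕜}
    (h : P - P' ∈ repIdeal 𝕜 A ee d) :
    (Ideal.Quotient.mk (repIdeal 𝕜 A ee d)) P = Ideal.Quotient.mk _ P' :=
  Ideal.Quotient.eq.2 h

theorem univMat_add (a b : A) : univMat 𝕜 ee d (a + b) = univMat 𝕜 ee d a + univMat 𝕜 ee d b := by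
  ext i j
  rw [Matrix.add_apply, univMat, univMat, univMat, of_apply, of_apply, of_apply, ← map_add]
  refine mk_eq_mk_of_sub (Ideal.subset_span (Or.inl (Or.inl (Or.inl ⟨a, b, i, j, ?_⟩))))
  ring

theorem univMat_smul (c : 𝕜) (a : A) : univMat 𝕜 ee d (c • a) = c • univMat 𝕜 ee d a := by
  ext i j
  have : (c • univMat 𝕜 ee d a) i j
      = Ideal.Quotient.mk _ (MvPolynomial.C c * MvPolynomial.X (a, i, j)) := by
    rw [MvPolynomial.C_mul']
    rfl
  rw [this, univMat, of_apply]
  exact mk_eq_mk_of_sub (Ideal.subset_span (Or.inl (Or.inl (Or.inr ⟨c, a, i, j, rfl⟩))))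

theorem univMat_mul (a b : A) : univMat 𝕜 ee d (a * b) = univMat 𝕜 ee d a * univMat 𝕜 ee d b := by
  ext i j
  rw [Matrix.mul_apply, univMat, univMat, univMat]
  simp only [of_apply]
  simp only [← map_mul]
  rw [← map_sum]
  exact mk_eq_mk_of_sub (Ideal.subset_span (Or.inl (Or.inr ⟨a, b, i, j, rfl⟩)))

theorem univMat_idem (s : Fin n) : univMat 𝕜 ee d (ee s) = blockE s := by
  ext i j
  have : (blockE s : Matrix (Idx d) (Idx d) (RepAlg 𝕜 A ee d)) i j
      = Ideal.Quotient.mk _ (if i = j ∧ i.1 = s then 1 else 0) := by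
    rw [blockE, diagonal_apply, ite_and]
    split_ifs <;> simp
  rw [this, univMat, of_apply]
  exact mk_eq_mk_of_sub (Ideal.subset_span (Or.inr ⟨s, i, j, rfl⟩))

variable (𝕜 d) in
/-- The universal representation of `A`, as an algebra homomorphism. -/
noncomputable def univHom (hee : ∑ s, ee s = 1) :
    A →ₐ[𝕜] Matrix (Idx d) (Idx d) (RepAlg 𝕜 A ee d) :=
  AlgHom.ofLinearMap
    { toFun := univMat 𝕜 ee d
      map_add' := univMat_add
      map_smul' := univMat_smul }
    (by
      let f : A →+ Matrix (Idx d) (Idx d) (RepAlg 𝕜 A ee d) :=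
        AddMonoidHom.mk' (univMat 𝕜 ee d) univMat_add
      change f 1 = 1
      rw [← hee, map_sum, ← sum_blockE]
      exact Finset.sum_congr rfl fun s _ => univMat_idem s)
    univMat_mul

variable {S : Type} [CommRing S] [Algebra 𝕜 S]

/-- A representation of `A` is a point of the representation scheme. -/
noncomputable def repLift (φ : A →ₐ[𝕜] Matrix (Idx d) (Idx d) S)
    (hφ : ∀ s, φ (ee s) = blockE s) : RepAlg 𝕜 A ee d →ₐ[𝕜] S :=
  Ideal.Quotient.liftₐ _ (MvPolynomial.aeval fun p => φ p.1 p.2.1 p.2.2) (by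
    intro P hP
    rw [← RingHom.mem_ker]
    revert P
    change repIdeal 𝕜 A ee d ≤ RingHom.ker (MvPolynomial.aeval fun p => φ p.1 p.2.1 p.2.2)
    refine Ideal.span_le.2 ?_
    rintro P (((⟨a, b, i, j, rfl⟩ | ⟨c, a, i, j, rfl⟩) | ⟨a, b, i, j, rfl⟩) | ⟨s, i, j, rfl⟩)
    · simp [RingHom.mem_ker]
    · simp [RingHom.mem_ker, ← Algebra.smul_def]
    · simp [RingHom.mem_ker, Matrix.mul_apply]
    · simp only [SetLike.mem_coe, RingHom.mem_ker, map_sub, MvPolynomial.aeval_X, hφ, blockE,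
        diagonal_apply, ite_and]
      split_ifs <;> simp)

theorem repLift_univMat (φ : A →ₐ[𝕜] Matrix (Idx d) (Idx d) S)
    (hφ : ∀ s, φ (ee s) = blockE s) (a : A) (i j : Idx d) :
    repLift φ hφ (univMat 𝕜 ee d a i j) = φ a i j := by
  exact MvPolynomial.aeval_X (fun p : A × Idx d × Idx d => φ p.1 p.2.1 p.2.2) (a, i, j)

theorem repAlg_hom_ext {f g : RepAlg 𝕜 A ee d →ₐ[𝕜] S}
    (h : ∀ a i j, f (univMat 𝕜 ee d a i j) = g (univMat 𝕜 ee d a i j)) : f = g := by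
  refine Ideal.Quotient.algHom_ext _ (MvPolynomial.algHom_ext fun p => ?_)
  exact h p.1 p.2.1 p.2.2

end Universal

section Boalch

open Matrix

variable {𝕜} {n : ℕ} {Q : ColoredQuiver n} {d : Fin n → ℕ} {S : Type} [CommRing S] [Algebra 𝕜 S]

variable (𝕜 Q) in
theorem sum_bE : ∑ s, bE 𝕜 Q s = 1 := by
  simp only [bE]
  rw [← map_sum, RingQuot.mkAlgHom_rel 𝕜 (BoalchRel.sum_one (𝕜 := 𝕜) (Q := Q)), map_one]

variable (𝕜 Q d) in
/-- The universal representation of the Boalch algebra, on the free algebra. -/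
noncomputable def boalchUniv : FreeAlgebra 𝕜 (BGen n Q.C) →ₐ[𝕜]
    Matrix (Idx d) (Idx d) (RepAlg 𝕜 (Boalch 𝕜 Q) (bE 𝕜 Q) d) :=
  (univHom 𝕜 d (sum_bE 𝕜 Q)).comp (RingQuot.mkAlgHom 𝕜 (BoalchRel 𝕜 Q))

theorem isRep_boalchUniv : IsRep (boalchUniv 𝕜 Q d) where
  idem s := univMat_idem s
  rel a b hab := by
    rw [boalchUniv, AlgHom.comp_apply, AlgHom.comp_apply, RingQuot.mkAlgHom_rel 𝕜 hab]

theorem IsRep.map {S' : Type} [CommRing S'] [Algebra 𝕜 S']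
    {Φ : FreeAlgebra 𝕜 (BGen n Q.C) →ₐ[𝕜] Matrix (Idx d) (Idx d) S} (h : IsRep Φ)
    (f : S →ₐ[𝕜] S') : IsRep (f.mapMatrix.comp Φ) where
  idem s := by
    rw [AlgHom.comp_apply, h.idem, blockE, blockE, AlgHom.mapMatrix_apply,
      diagonal_map (map_zero f)]
    congr 1
    ext a
    split_ifs <;> simp
  rel a b hab := by rw [AlgHom.comp_apply, AlgHom.comp_apply, h.rel a b hab]

/-- The point of the representation scheme given by a representation of the Boalch algebra. -/
noncomputable def IsRep.lift {Φ : FreeAlgebra 𝕜 (BGen n Q.C) →ₐ[𝕜] Matrix (Idx d) (Idx d) S}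
    (h : IsRep Φ) : RepAlg 𝕜 (Boalch 𝕜 Q) (bE 𝕜 Q) d →ₐ[𝕜] S :=
  repLift (RingQuot.liftAlgHom 𝕜 ⟨Φ, h.rel⟩) fun s =>
    (RingQuot.liftAlgHom_mkAlgHom_apply 𝕜 Φ h.rel _).trans (h.idem s)

theorem IsRep.lift_apply {Φ : FreeAlgebra 𝕜 (BGen n Q.C) →ₐ[𝕜] Matrix (Idx d) (Idx d) S}
    (h : IsRep Φ) (y : FreeAlgebra 𝕜 (BGen n Q.C)) (i j : Idx d) :
    h.lift (boalchUniv 𝕜 Q d y i j) = Φ y i j := by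
  have := RingQuot.liftAlgHom_mkAlgHom_apply 𝕜 Φ h.rel y
  exact (repLift_univMat _ _ _ i j).trans (congrFun (congrFun this i) j)

/-- A point of the representation scheme is determined by the matrices of the arrows of `Ῡ`. -/
theorem boalch_hom_ext {f g : RepAlg 𝕜 (Boalch 𝕜 Q) (bE 𝕜 Q) d →ₐ[𝕜] S}
    (h : ∀ c i j a b, f (boalchUniv 𝕜 Q d (bfV 𝕜 Q c i j) a b)
      = g (boalchUniv 𝕜 Q d (bfV 𝕜 Q c i j) a b)) : f = g := by
  have key := (isRep_boalchUniv.map f).ext (isRep_boalchUniv (𝕜 := 𝕜) (Q := Q) (d := d).map g)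
    fun c i j => by ext a b; exact h c i j a b
  refine repAlg_hom_ext fun a i j => ?_
  obtain ⟨y, rfl⟩ := RingQuot.mkAlgHom_surjective 𝕜 (BoalchRel 𝕜 Q) a
  exact congrFun (congrFun (DFunLike.congr_fun key y) i) j

variable (Q d) in
/-- The entries of the matrices of the arrows of the double `Ῡ`. -/
abbrev ArrowIdx : Type := {p : Q.C × Idx d × Idx d // Q.DArr p.1 p.2.1.1 p.2.2.1}

variable (𝕜 Q d) in
/-- The coordinates on the representation space of the double `Ῡ`. -/
noncomputable def coordFn (c : Q.C) (a b : Idx d) : MvPolynomial (ArrowIdx Q d) 𝕜 :=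
  if h : Q.DArr c a.1 b.1 then MvPolynomial.X ⟨(c, a, b), h⟩ else 0

theorem arrowMat_apply_of_dArr (x : Q.C → Idx d → Idx d → S) {c : Q.C} {a b : Idx d}
    (h : Q.DArr c a.1 b.1) : arrowMat x c a.1 b.1 a b = x c a b :=
  if_pos ⟨rfl, rfl, h⟩

theorem IsRep.map_bfV {Φ : FreeAlgebra 𝕜 (BGen n Q.C) →ₐ[𝕜] Matrix (Idx d) (Idx d) S}
    (h : IsRep Φ) {x : Q.C → Idx d → Idx d → S}
    (hx : ∀ c a b, Q.DArr c a.1 b.1 → x c a b = Φ (bfV 𝕜 Q c a.1 b.1) a b) (c : Q.C)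
    (i j : Fin n) : Φ (bfV 𝕜 Q c i j) = arrowMat x c i j := by
  refine congrFun (congrFun ((h.blockSupported_V c).ext (blockSupported_arrowMat x c) ?_) i) j
  intro a b
  by_cases hd : Q.DArr c a.1 b.1
  · rw [arrowMat_apply_of_dArr x hd, hx c a b hd]
  · rw [arrowMat_eq_zero x hd, h.rel _ _ (.vzero c _ _ hd), map_zero]

theorem constantCoeff_disc_coordFn : MvPolynomial.constantCoeff (disc (coordFn 𝕜 Q d)) = 1 := by
  have : (fun c a b => MvPolynomial.constantCoeff (coordFn 𝕜 Q d c a b))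
      = (fun _ _ _ => 0 : Q.C → Idx d → Idx d → 𝕜) := by
    ext c a b
    rw [coordFn]
    split_ifs <;> simp
  rw [disc_map, this]
  exact disc_zero

variable (𝕜 Q d) in
/-- The representation scheme of the Boalch algebra is a principal open subscheme of the
representation space of the double `Ῡ`. -/
theorem nonempty_repAlg_equiv : Nonempty (RepAlg 𝕜 (Boalch 𝕜 Q) (bE 𝕜 Q) d ≃ₐ[𝕜]
    Localization.Away (disc (coordFn 𝕜 Q d))) := by
  set f := disc (coordFn 𝕜 Q d) with hf
  let R := RepAlg 𝕜 (Boalch 𝕜 Q) (bE 𝕜 Q) d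
  let L := Localization.Away f
  let θ : MvPolynomial (ArrowIdx Q d) 𝕜 →ₐ[𝕜] R := MvPolynomial.aeval fun p =>
    boalchUniv 𝕜 Q d (bfV 𝕜 Q p.1.1 p.1.2.1.1 p.1.2.2.1) p.1.2.1 p.1.2.2
  have hθ : ∀ c a b, Q.DArr c a.1 b.1 →
      θ (coordFn 𝕜 Q d c a b) = boalchUniv 𝕜 Q d (bfV 𝕜 Q c a.1 b.1) a b := fun c a b h => by
    rw [coordFn, dif_pos h]
    exact MvPolynomial.aeval_X _ _
  have hθf : IsUnit (θ f) := by
    have := isRep_boalchUniv.isUnit_disc (isRep_boalchUniv.map_bfV hθ)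
    rwa [hf, ← RingHom.coe_coe, disc_map]
  let α : L →ₐ[𝕜] R := IsLocalization.liftAlgHom (M := Submonoid.powers f) (f := θ) (by
    rintro ⟨_, k, rfl⟩
    rw [map_pow]
    exact hθf.pow k)
  have hα : ∀ P, α (algebraMap _ L P) = θ P := fun P => by
    simp only [α, IsLocalization.liftAlgHom_apply]
    exact IsLocalization.lift_eq _ P
  let ι : MvPolynomial (ArrowIdx Q d) 𝕜 →ₐ[𝕜] L := IsScalarTower.toAlgHom 𝕜 _ L
  obtain ⟨Φ, hΦ, hΦV⟩ := exists_isRep (𝕜 := 𝕜)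
    (x := fun c a b => (ι : MvPolynomial (ArrowIdx Q d) 𝕜 →+* L) (coordFn 𝕜 Q d c a b)) (by
      rw [← disc_map]
      exact IsLocalization.Away.algebraMap_isUnit f)
  have hβ : ∀ c i j a b, hΦ.lift (boalchUniv 𝕜 Q d (bfV 𝕜 Q c i j) a b)
      = arrowMat (fun c a b => ι (coordFn 𝕜 Q d c a b)) c i j a b := fun c i j a b => by
    rw [hΦ.lift_apply, hΦV]
    rfl
  refine ⟨AlgEquiv.ofAlgHom hΦ.lift α ?_ ?_⟩
  · refine IsLocalization.algHom_ext (Submonoid.powers f) (MvPolynomial.algHom_ext ?_)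
    rintro ⟨⟨c, a, b⟩, h⟩
    have hX : MvPolynomial.X ⟨(c, a, b), h⟩ = coordFn 𝕜 Q d c a b := by rw [coordFn, dif_pos h]
    rw [hX]
    change hΦ.lift (α (algebraMap _ L _)) = ι _
    rw [hα, hθ c a b h, hβ, arrowMat_apply_of_dArr _ h]
  · refine boalch_hom_ext fun c i j a b => ?_
    rw [isRep_boalchUniv.map_bfV hθ, AlgHom.comp_apply, AlgHom.id_apply,
      ← isRep_boalchUniv.map_bfV hθ, hβ, isRep_boalchUniv.map_bfV hθ, arrowMat, arrowMat,
      of_apply, of_apply]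
    split_ifs
    · exact hα _
    · exact map_zero α

theorem card_arrowIdx : Nat.card (ArrowIdx Q d) = 2 * ∑ c : Q.C, ∑ p ∈ Finset.univ.filter
    (fun p : Fin n × Fin n => Q.Arr c p.1 p.2), d p.2 * d p.1 := by
  have hD : ∀ c (p : Fin n × Fin n), (if Q.DArr c p.1 p.2 then d p.1 * d p.2 else 0)
      = (if Q.Arr c p.1 p.2 then d p.2 * d p.1 else 0)
        + if Q.Arr c p.2 p.1 then d p.1 * d p.2 else 0 := fun c p => by
    simp only [ColoredQuiver.DArr, ColoredQuiver.Arr]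
    rcases lt_trichotomy p.1 p.2 with h | h | h
    · simp [h, h.ne, h.not_gt, mul_comm]
    · simp [h]
    · simp [h, h.ne', h.not_gt, ne_comm, and_left_comm]
  have hS : ∀ c : Q.C, ∑ p : Fin n × Fin n, (if Q.DArr c p.1 p.2 then d p.1 * d p.2 else 0)
      = 2 * ∑ p ∈ Finset.univ.filter
        (fun p : Fin n × Fin n => Q.Arr c p.1 p.2), d p.2 * d p.1 := fun c => by
    rw [Finset.sum_congr rfl fun p _ => hD c p, Finset.sum_add_distrib, two_mul,
      Finset.sum_filter]
    congr 1
    exact Fintype.sum_equiv (Equiv.prodComm _ _) _ _ fun p => rfl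
  rw [Finset.mul_sum, ← Finset.sum_congr rfl fun c _ => hS c, Nat.card_eq_fintype_card,
    Fintype.card_subtype, Finset.card_filter, Fintype.sum_prod_type]
  refine Finset.sum_congr rfl fun c _ => ?_
  rw [Fintype.sum_prod_type, Fintype.sum_sigma, Fintype.sum_prod_type]
  refine Finset.sum_congr rfl fun i _ => ?_
  simp only [Fintype.sum_sigma]
  rw [Finset.sum_comm]
  exact Finset.sum_congr rfl fun j _ => by split_ifs <;> simp

end Boalch

/-- Lemma 3.11. For a colored quiver `Υ` and any dimension vector
`d`, the representation scheme `Rep(B(Υ), d)` of the Boalch algebra relative to `B` is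
nonempty (its coordinate ring is nontrivial), and its dimension over `𝕜` (the Krull
dimension of its coordinate ring) equals `2 ∑_{a ∈ Υ} d_{t(a)} d_{h(a)}`, the sum being
over the arrows of `Υ`. -/
theorem statement_3 (𝕜 : Type) [Field 𝕜] [CharZero 𝕜] {n : ℕ} (Q : ColoredQuiver n)
    (d : Fin n → ℕ) :
    Nontrivial (RepAlg 𝕜 (Boalch 𝕜 Q) (bE 𝕜 Q) d)
    ∧ ringKrullDim (RepAlg 𝕜 (Boalch 𝕜 Q) (bE 𝕜 Q) d)
        = ((2 * ∑ c : Q.C, ∑ p ∈ Finset.univ.filter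
              (fun p : Fin n × Fin n => Q.Arr c p.1 p.2), d p.2 * d p.1 : ℕ) :
            WithBot (WithTop ℕ)) := by
  obtain ⟨e⟩ := nonempty_repAlg_equiv 𝕜 Q d
  have hc : MvPolynomial.constantCoeff (disc (coordFn 𝕜 Q d)) ≠ 0 := by
    rw [constantCoeff_disc_coordFn]
    exact one_ne_zero
  have hdim := (ringKrullDim_eq_of_ringEquiv e.toRingEquiv).trans
    ((ringKrullDim_away_eq_natCard _ _ hc).trans (congrArg _ card_arrowIdx))
  refine ⟨?_, hdim⟩
  by_contra hn
  rw [not_nontrivial_iff_subsingleton] at hn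
  rw [ringKrullDim_eq_bot_of_subsingleton] at hdim
  exact WithBot.bot_ne_natCast _ hdim

end NCQP
end

section
/- The Boalch algebra B(I) of the monochromatic interval, equipped with its double quasi-Poisson bracket determined by {{v_{12},v_{12}}} = 0 = {{v_{21},v_{21}}} and {{v_{21},v_{12}}} = e_1⊗e_2 + (1/2)(v_{12}v_{21}⊗e_2 + e_1⊗v_{21}v_{12}), satisfies on all generators: {{w_{21},v_{21}}} = (1/2)(w_{21}⊗v_{21} + v_{21}⊗w_{21}); {{w_{12},v_{12}}} = −(1/2)(w_{12}⊗v_{12} + v_{12}⊗w_{12}); {{w_{21},v_{12}}} = (1/2) e_1⊗γ_2^{-1} + (1/2) γ_1⊗e_2; {{w_{12},v_{21}}} = −(1/2)(γ_2^{-1}⊗e_1 + e_2⊗γ_1); {{w_{12},w_{12}}} = 0 = {{w_{21},w_{21}}}; and {{w_{21},w_{12}}} = γ_1⊗γ_2^{-1} − (1/2)(w_{12}w_{21}⊗e_2 + e_1⊗w_{21}w_{12}). -/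
open TensorProduct

namespace NCQP

variable (𝕜 : Type) [Field 𝕜] [CharZero 𝕜]

/-- A double bracket on a `𝕜`-algebra `A`: a bilinear map `A × A → A ⊗ A` satisfying
cyclic antisymmetry and the Leibniz rule in its second argument (for the outer bimodule
structure on `A ⊗ A`). -/
structure DoubleBracket (A : Type) [Ring A] [Algebra 𝕜 A] where
  br : A →ₗ[𝕜] A →ₗ[𝕜] A ⊗[𝕜] A
  cyclic : ∀ a b : A, br b a = - (TensorProduct.comm 𝕜 A A) (br a b)
  leibniz : ∀ a b c : A, br a (b * c) = br a b * ((1 : A) ⊗ₜ[𝕜] c) + ((b : A) ⊗ₜ[𝕜] (1 : A)) * br a c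

variable {𝕜}
variable {A : Type} [Ring A] [Algebra 𝕜 A]

/-- The permutation `τ_(132)` on `A ⊗ A ⊗ A`, sending `a ⊗ b ⊗ c` to `b ⊗ c ⊗ a`. -/
noncomputable def tau132 (𝕜 : Type) [Field 𝕜] (A : Type) [Ring A] [Algebra 𝕜 A] :
    (A ⊗[𝕜] (A ⊗[𝕜] A)) ≃ₗ[𝕜] (A ⊗[𝕜] (A ⊗[𝕜] A)) :=
  (TensorProduct.comm 𝕜 A (A ⊗[𝕜] A)).trans (TensorProduct.assoc 𝕜 A A A)

/-- The permutation `τ_(123)` on `A ⊗ A ⊗ A`, sending `a ⊗ b ⊗ c` to `c ⊗ a ⊗ b`. -/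
noncomputable def tau123 (𝕜 : Type) [Field 𝕜] (A : Type) [Ring A] [Algebra 𝕜 A] :
    (A ⊗[𝕜] (A ⊗[𝕜] A)) ≃ₗ[𝕜] (A ⊗[𝕜] (A ⊗[𝕜] A)) :=
  (tau132 𝕜 A).trans (tau132 𝕜 A)

/-- Extension of a linear map `φ : A → A ⊗ A` to `A ⊗ A → A ⊗ A ⊗ A` acting on the left
factor: `b ⊗ c ↦ φ(b) ⊗ c`. -/
noncomputable def extL (𝕜 : Type) [Field 𝕜] (A : Type) [Ring A] [Algebra 𝕜 A]
    (φ : A →ₗ[𝕜] A ⊗[𝕜] A) : A ⊗[𝕜] A →ₗ[𝕜] A ⊗[𝕜] (A ⊗[𝕜] A) :=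
  (TensorProduct.assoc 𝕜 A A A).toLinearMap.comp (LinearMap.rTensor A φ)

/-- The triple bracket `{{a,b,c}}` associated with a double bracket. -/
noncomputable def tripleBr (D : DoubleBracket 𝕜 A) (a b c : A) : A ⊗[𝕜] (A ⊗[𝕜] A) :=
  extL 𝕜 A (D.br a) (D.br b c) + tau123 𝕜 A (extL 𝕜 A (D.br b) (D.br c a))
    + tau132 𝕜 A (extL 𝕜 A (D.br c) (D.br a b))

/-- The quasi-Poisson trivector term `{{a,b,c}}_qP` associated with a family of
orthogonal idempotents `e`. -/
noncomputable def tripleQP {I : Type} [Fintype I] (e : I → A) (a b c : A) :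
    A ⊗[𝕜] (A ⊗[𝕜] A) :=
  (4 : 𝕜)⁻¹ • ∑ s : I,
    ( (c * e s * a) ⊗ₜ[𝕜] ((e s * b) ⊗ₜ[𝕜] (e s))
    - (c * e s * a) ⊗ₜ[𝕜] ((e s) ⊗ₜ[𝕜] (b * e s))
    - (c * e s) ⊗ₜ[𝕜] ((a * e s * b) ⊗ₜ[𝕜] (e s))
    + (c * e s) ⊗ₜ[𝕜] ((a * e s) ⊗ₜ[𝕜] (b * e s))
    - (e s * a) ⊗ₜ[𝕜] ((e s * b) ⊗ₜ[𝕜] (e s * c))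
    + (e s * a) ⊗ₜ[𝕜] ((e s) ⊗ₜ[𝕜] (b * e s * c))
    + (e s) ⊗ₜ[𝕜] ((a * e s * b) ⊗ₜ[𝕜] (e s * c))
    - (e s) ⊗ₜ[𝕜] ((a * e s) ⊗ₜ[𝕜] (b * e s * c)) )

/-- The double bracket is quasi-Poisson relative to the idempotent family `e`. -/
def IsQuasiPoisson {I : Type} [Fintype I] (D : DoubleBracket 𝕜 A) (e : I → A) : Prop :=
  ∀ a b c : A, tripleBr D a b c = tripleQP e a b c

/-- `Φ = ∑ s, Φ s` is a multiplicative moment map for the double bracket `D`. -/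
def IsMomentMap {I : Type} [Fintype I] (D : DoubleBracket 𝕜 A) (e : I → A) (Φ : I → A) :
    Prop :=
  (∀ s, Φ s = e s * Φ s * e s) ∧ IsUnit (∑ s, Φ s) ∧
    ∀ s (a : A), D.br (Φ s) a =
      (2 : 𝕜)⁻¹ • ((a * e s) ⊗ₜ[𝕜] (Φ s) - (e s) ⊗ₜ[𝕜] (Φ s * a)
        + (a * Φ s) ⊗ₜ[𝕜] (e s) - (Φ s) ⊗ₜ[𝕜] (e s * a))

/-- The triple `(A, D, Φ)` is a Hamiltonian double quasi-Poisson algebra. -/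
def IsHamiltonian {I : Type} [Fintype I] (D : DoubleBracket 𝕜 A) (e : I → A) (Φ : I → A) :
    Prop :=
  IsQuasiPoisson D e ∧ IsMomentMap D e Φ

/-- The double bracket is `B`-linear, i.e. vanishes when an argument lies in the
semisimple subalgebra spanned by the idempotents `e`. -/
def VanishesOnIdem {I : Type} (D : DoubleBracket 𝕜 A) (e : I → A) : Prop :=
  ∀ s, D.br (e s) = 0


variable (𝕜 : Type) [Field 𝕜] [CharZero 𝕜]

/-- Generators of the Boalch algebra of the monochromatic interval. -/
inductive IGen : Type
  | e1 | e2 | v12 | v21 | w12 | w21 | g1 | g2 | g1i | g2i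

open IGen in
/-- The defining relations of the Boalch algebra `B(I)` of the monochromatic
interval. -/
inductive IRel : FreeAlgebra 𝕜 IGen → FreeAlgebra 𝕜 IGen → Prop
  | e11 : IRel (FreeAlgebra.ι 𝕜 e1 * FreeAlgebra.ι 𝕜 e1) (FreeAlgebra.ι 𝕜 e1)
  | e22 : IRel (FreeAlgebra.ι 𝕜 e2 * FreeAlgebra.ι 𝕜 e2) (FreeAlgebra.ι 𝕜 e2)
  | e12 : IRel (FreeAlgebra.ι 𝕜 e1 * FreeAlgebra.ι 𝕜 e2) 0
  | e21 : IRel (FreeAlgebra.ι 𝕜 e2 * FreeAlgebra.ι 𝕜 e1) 0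
  | sum_one : IRel (FreeAlgebra.ι 𝕜 e1 + FreeAlgebra.ι 𝕜 e2) 1
  | v12s : IRel (FreeAlgebra.ι 𝕜 v12)
      (FreeAlgebra.ι 𝕜 e1 * FreeAlgebra.ι 𝕜 v12 * FreeAlgebra.ι 𝕜 e2)
  | v21s : IRel (FreeAlgebra.ι 𝕜 v21)
      (FreeAlgebra.ι 𝕜 e2 * FreeAlgebra.ι 𝕜 v21 * FreeAlgebra.ι 𝕜 e1)
  | w12s : IRel (FreeAlgebra.ι 𝕜 w12)
      (FreeAlgebra.ι 𝕜 e1 * FreeAlgebra.ι 𝕜 w12 * FreeAlgebra.ι 𝕜 e2)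
  | w21s : IRel (FreeAlgebra.ι 𝕜 w21)
      (FreeAlgebra.ι 𝕜 e2 * FreeAlgebra.ι 𝕜 w21 * FreeAlgebra.ι 𝕜 e1)
  | g1s : IRel (FreeAlgebra.ι 𝕜 g1)
      (FreeAlgebra.ι 𝕜 e1 * FreeAlgebra.ι 𝕜 g1 * FreeAlgebra.ι 𝕜 e1)
  | g2s : IRel (FreeAlgebra.ι 𝕜 g2)
      (FreeAlgebra.ι 𝕜 e2 * FreeAlgebra.ι 𝕜 g2 * FreeAlgebra.ι 𝕜 e2)
  | g1is : IRel (FreeAlgebra.ι 𝕜 g1i)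
      (FreeAlgebra.ι 𝕜 e1 * FreeAlgebra.ι 𝕜 g1i * FreeAlgebra.ι 𝕜 e1)
  | g2is : IRel (FreeAlgebra.ι 𝕜 g2i)
      (FreeAlgebra.ι 𝕜 e2 * FreeAlgebra.ι 𝕜 g2i * FreeAlgebra.ι 𝕜 e2)
  | g1inv : IRel (FreeAlgebra.ι 𝕜 g1 * FreeAlgebra.ι 𝕜 g1i) (FreeAlgebra.ι 𝕜 e1)
  | g1inv' : IRel (FreeAlgebra.ι 𝕜 g1i * FreeAlgebra.ι 𝕜 g1) (FreeAlgebra.ι 𝕜 e1)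
  | g2inv : IRel (FreeAlgebra.ι 𝕜 g2 * FreeAlgebra.ι 𝕜 g2i) (FreeAlgebra.ι 𝕜 e2)
  | g2inv' : IRel (FreeAlgebra.ι 𝕜 g2i * FreeAlgebra.ι 𝕜 g2) (FreeAlgebra.ι 𝕜 e2)
  | main : IRel ((1 + FreeAlgebra.ι 𝕜 v21) * (1 + FreeAlgebra.ι 𝕜 v12))
      ((1 + FreeAlgebra.ι 𝕜 w12) * (FreeAlgebra.ι 𝕜 g1 + FreeAlgebra.ι 𝕜 g2) *
        (1 + FreeAlgebra.ι 𝕜 w21))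

/-- The Boalch algebra `B(I)` of the monochromatic interval. -/
abbrev BI : Type := RingQuot (IRel 𝕜)

noncomputable def iE1 : BI 𝕜 := RingQuot.mkAlgHom 𝕜 (IRel 𝕜) (FreeAlgebra.ι 𝕜 IGen.e1)
noncomputable def iE2 : BI 𝕜 := RingQuot.mkAlgHom 𝕜 (IRel 𝕜) (FreeAlgebra.ι 𝕜 IGen.e2)
noncomputable def iV12 : BI 𝕜 := RingQuot.mkAlgHom 𝕜 (IRel 𝕜) (FreeAlgebra.ι 𝕜 IGen.v12)
noncomputable def iV21 : BI 𝕜 := RingQuot.mkAlgHom 𝕜 (IRel 𝕜) (FreeAlgebra.ι 𝕜 IGen.v21)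
noncomputable def iW12 : BI 𝕜 := RingQuot.mkAlgHom 𝕜 (IRel 𝕜) (FreeAlgebra.ι 𝕜 IGen.w12)
noncomputable def iW21 : BI 𝕜 := RingQuot.mkAlgHom 𝕜 (IRel 𝕜) (FreeAlgebra.ι 𝕜 IGen.w21)
noncomputable def iG1 : BI 𝕜 := RingQuot.mkAlgHom 𝕜 (IRel 𝕜) (FreeAlgebra.ι 𝕜 IGen.g1)
noncomputable def iG2 : BI 𝕜 := RingQuot.mkAlgHom 𝕜 (IRel 𝕜) (FreeAlgebra.ι 𝕜 IGen.g2)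
noncomputable def iG1i : BI 𝕜 := RingQuot.mkAlgHom 𝕜 (IRel 𝕜) (FreeAlgebra.ι 𝕜 IGen.g1i)
noncomputable def iG2i : BI 𝕜 := RingQuot.mkAlgHom 𝕜 (IRel 𝕜) (FreeAlgebra.ι 𝕜 IGen.g2i)

/-- The family of orthogonal idempotents `e₁, e₂` of `B(I)`. -/
noncomputable def iIdem : Fin 2 → BI 𝕜 := ![iE1 𝕜, iE2 𝕜]

/-- The family `Φ₁ = γ₁, Φ₂ = γ₂` of components of the moment map. -/
noncomputable def iPhi : Fin 2 → BI 𝕜 := ![iG1 𝕜, iG2 𝕜]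

namespace DoubleBracket

variable {K R : Type} [Field K] [Ring R] [Algebra K R] (D : DoubleBracket K R)

/-- The Leibniz rule for the bracket with an inverse `h` of `g` in the corner of an idempotent
`f` on which the bracket vanishes. -/
theorem br_corner_inv {f g h u : R} (hf : D.br u f = 0) (hg : h * g = f) (gh : g * h = f)
    (hf' : h * f = h) :
    D.br u h = -((h ⊗ₜ[K] (1 : R)) * D.br u g * ((1 : R) ⊗ₜ[K] h)) := by
  have key := D.leibniz u h g
  rw [hg, hf] at key
  have hright : D.br u h = D.br u h * ((1 : R) ⊗ₜ[K] f) := by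
    have := D.leibniz u h f
    rwa [hf', hf, mul_zero, add_zero] at this
  have hmul : D.br u h * ((1 : R) ⊗ₜ[K] g) = -((h ⊗ₜ[K] (1 : R)) * D.br u g) :=
    eq_neg_of_add_eq_zero_left key.symm
  calc D.br u h = D.br u h * ((1 : R) ⊗ₜ[K] g) * ((1 : R) ⊗ₜ[K] h) := by
        rw [mul_assoc, Algebra.TensorProduct.tmul_mul_tmul, one_mul, gh, ← hright]
    _ = _ := by rw [hmul, neg_mul]

/-- A double bracket vanishes on `f` in the second argument as soon as it vanishes on `f` in the
first. -/
theorem br_right_eq_zero {f : R} (hf : D.br f = 0) (u : R) : D.br u f = 0 := by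
  rw [D.cyclic f u, hf, LinearMap.zero_apply, map_zero, neg_zero]

variable [CharZero K]

/-- The brackets of `a h` and `h b`, where `h` is the inverse of `f + b a` in the corner of `f`,
for elements `a`, `b` with the bracket of `v₁₂`, `v₂₁`. -/
theorem br_interval {e f a b g h G : R}
    (ea : e * a = a) (af : a * f = a) (fb : f * b = b) (be : b * e = b)
    (fh : f * h = h) (hf : h * f = h) (gh : g * h = f) (hg : h * g = f)
    (ba : b * a = g - f) (ahb : a * (h * b) = e - G) (D0 : D.br f = 0)
    (h1 : D.br a a = 0) (h2 : D.br b b = 0)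
    (h3 : D.br b a = e ⊗ₜ[K] f
      + (2 : K)⁻¹ • ((a * b) ⊗ₜ[K] f + e ⊗ₜ[K] (b * a))) :
    D.br (h * b) b = (2 : K)⁻¹ • ((h * b) ⊗ₜ[K] b + b ⊗ₜ[K] (h * b))
    ∧ D.br (a * h) a = - ((2 : K)⁻¹ • ((a * h) ⊗ₜ[K] a + a ⊗ₜ[K] (a * h)))
    ∧ D.br (h * b) a = (2 : K)⁻¹ • (e ⊗ₜ[K] h) + (2 : K)⁻¹ • (G ⊗ₜ[K] f)
    ∧ D.br (a * h) b = - ((2 : K)⁻¹ • (h ⊗ₜ[K] e + f ⊗ₜ[K] G))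
    ∧ D.br (a * h) (a * h) = 0
    ∧ D.br (h * b) (h * b) = 0
    ∧ D.br (h * b) (a * h) = G ⊗ₜ[K] h
        - (2 : K)⁻¹ • ((a * h * (h * b)) ⊗ₜ[K] f + e ⊗ₜ[K] (h * b * (a * h))) := by
  have bat (t : R) : b * (a * t) = g * t - f * t := by rw [← mul_assoc, ba, sub_mul]
  have ght (t : R) : g * (h * t) = f * t := by rw [← mul_assoc, gh]
  have hgt (t : R) : h * (g * t) = f * t := by rw [← mul_assoc, hg]
  have hft (t : R) : h * (f * t) = h * t := by rw [← mul_assoc, hf]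
  have eG : G = e - a * (h * b) := by rw [ahb, sub_sub_cancel]
  have g_eq : g = b * a + f := by rw [ba, sub_add_cancel]
  have br_f (u : R) : D.br u f = 0 := D.br_right_eq_zero D0 u
  have br_h (u : R) := D.br_corner_inv (br_f u) hg gh hf
  have br_g (u : R) : D.br u g = D.br u b * ((1 : R) ⊗ₜ[K] a) + (b ⊗ₜ[K] (1 : R)) * D.br u a := by
    rw [g_eq, map_add, br_f, add_zero, D.leibniz]
  have h3' : D.br a b = -(f ⊗ₜ[K] e + (2 : K)⁻¹ • (f ⊗ₜ[K] (a * b) + (b * a) ⊗ₜ[K] e)) := by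
    rw [D.cyclic b a, h3]
    simp only [map_add, map_smul, TensorProduct.comm_tmul]
  rw [ba] at h3 h3'
  have a_h : D.br a h = (2 : K)⁻¹ • (h ⊗ₜ[K] a + f ⊗ₜ[K] (a * h)) := by
    rw [br_h, br_g, h3', h1]
    simp only [add_mul, mul_add, sub_mul, mul_sub, neg_mul, mul_neg, smul_mul_assoc, mul_smul_comm,
      Algebra.TensorProduct.tmul_mul_tmul, TensorProduct.tmul_sub, TensorProduct.sub_tmul,
      mul_zero, add_zero, one_mul, mul_one, mul_assoc, ea, af, hf, gh, hg, ba]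
    module
  have b_h : D.br b h = -((2 : K)⁻¹ • (b ⊗ₜ[K] h + (h * b) ⊗ₜ[K] f)) := by
    rw [br_h, br_g, h3, h2]
    simp only [add_mul, mul_add, sub_mul, mul_sub, smul_mul_assoc, mul_smul_comm,
      Algebra.TensorProduct.tmul_mul_tmul, TensorProduct.tmul_sub, TensorProduct.sub_tmul,
      zero_mul, zero_add, one_mul, mul_one, fb, be, fh, gh, bat, hgt]
    module
  have y_b : D.br (h * b) b = (2 : K)⁻¹ • ((h * b) ⊗ₜ[K] b + b ⊗ₜ[K] (h * b)) := by
    rw [D.cyclic b, D.leibniz, b_h, h2]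
    simp only [map_add, map_neg, map_smul, TensorProduct.comm_tmul, add_mul, neg_mul,
      smul_mul_assoc, Algebra.TensorProduct.tmul_mul_tmul, mul_zero, add_zero, mul_one, fb]
    module
  have x_a : D.br (a * h) a = - ((2 : K)⁻¹ • ((a * h) ⊗ₜ[K] a + a ⊗ₜ[K] (a * h))) := by
    rw [D.cyclic a, D.leibniz, a_h, h1]
    simp only [map_add, map_smul, TensorProduct.comm_tmul, mul_add, mul_smul_comm,
      Algebra.TensorProduct.tmul_mul_tmul, zero_mul, zero_add, one_mul, af]
    module
  have y_a : D.br (h * b) a = (2 : K)⁻¹ • (e ⊗ₜ[K] h) + (2 : K)⁻¹ • (G ⊗ₜ[K] f) := by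
    rw [D.cyclic a, D.leibniz, a_h, h3', eG]
    simp only [map_add, map_sub, map_neg, map_smul, TensorProduct.comm_tmul, add_mul, mul_add,
      mul_sub, mul_neg, smul_mul_assoc, mul_smul_comm, Algebra.TensorProduct.tmul_mul_tmul,
      TensorProduct.sub_tmul, one_mul, mul_one, mul_assoc, hf, hg]
    module
  have x_b : D.br (a * h) b = - ((2 : K)⁻¹ • (h ⊗ₜ[K] e + f ⊗ₜ[K] G)) := by
    rw [D.cyclic b, D.leibniz, b_h, h3, eG]
    simp only [map_add, map_sub, map_neg, map_smul, TensorProduct.comm_tmul, add_mul, mul_add,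
      sub_mul, mul_neg, smul_mul_assoc, mul_smul_comm, Algebra.TensorProduct.tmul_mul_tmul,
      TensorProduct.tmul_sub, one_mul, mul_one, fh, gh]
    module
  refine ⟨y_b, x_a, y_a, x_b, ?_, ?_, ?_⟩
  · rw [D.leibniz, br_h, br_g, x_a, x_b, eG]
    simp only [add_mul, mul_add, sub_mul, mul_sub, neg_mul, mul_neg, smul_mul_assoc, mul_smul_comm,
      Algebra.TensorProduct.tmul_mul_tmul, TensorProduct.tmul_sub, TensorProduct.sub_tmul, one_mul,
      mul_one, mul_assoc, ea, af, fh, hf, gh, hg, ba, bat]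
    module
  · rw [D.leibniz, br_h, br_g, y_a, y_b, eG]
    simp only [add_mul, mul_add, sub_mul, mul_sub, neg_mul, smul_mul_assoc, mul_smul_comm,
      Algebra.TensorProduct.tmul_mul_tmul, TensorProduct.tmul_sub, TensorProduct.sub_tmul, one_mul,
      mul_one, mul_assoc, fb, be, fh, hf, gh, hg, ba, bat, ght, hft]
    module
  · rw [D.leibniz, br_h, br_g, y_a, y_b, eG]
    simp only [add_mul, mul_add, sub_mul, mul_sub, mul_neg, smul_mul_assoc, mul_smul_comm,
      Algebra.TensorProduct.tmul_mul_tmul, TensorProduct.tmul_sub, TensorProduct.sub_tmul, one_mul,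
      mul_one, mul_assoc, fb, be, fh, hf, gh, hg, ba, bat, ght, hft]
    module

end DoubleBracket

/-- The one-sided Peirce relations of an element `x = p x q`. -/
theorem peirce_relations {R : Type*} [Ring R] {p q p' q' x : R} (pp : p * p = p) (qq : q * q = q)
    (hp : p' * p = 0) (hq : q * q' = 0) (hx : x = p * x * q) :
    p * x = x ∧ x * q = x ∧ p' * x = 0 ∧ x * q' = 0 := by
  have px : p * x = x := by rw [hx]; simp only [← mul_assoc, pp]
  have xq : x * q = x := by rw [hx]; simp only [mul_assoc, qq]
  refine ⟨px, xq, ?_, ?_⟩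
  · rw [← px, ← mul_assoc, hp, zero_mul]
  · rw [← xq, mul_assoc, hq, mul_zero]

/-- The Peirce components of the main relation of `B(I)` for the decomposition
`1 = e₁ + e₂`. -/
theorem peirce_components_of_factorization {R : Type*} [Ring R] {e f a b x y G g : R}
    (ee : e * e = e) (ff : f * f = f) (ef : e * f = 0) (fe : f * e = 0)
    (ha : a = e * a * f) (hb : b = f * b * e) (hx : x = e * x * f) (hy : y = f * y * e)
    (hG : G = e * G * e) (hg : g = f * g * f)
    (main : (1 + b) * (1 + a) = (1 + x) * (G + g) * (1 + y)) :
    e = G + x * (g * y) ∧ a = x * g ∧ b = g * y ∧ f + b * a = g := by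
  obtain ⟨ea, af, fa, ae⟩ := peirce_relations ee ff fe fe ha
  obtain ⟨fb, be, eb, bf⟩ := peirce_relations ff ee ef ef hb
  obtain ⟨ex, xf, fx, xe⟩ := peirce_relations ee ff fe fe hx
  obtain ⟨fy, ye, ey, yf⟩ := peirce_relations ff ee ef ef hy
  obtain ⟨eG, Ge, fG, Gf⟩ := peirce_relations ee ee fe ef hG
  obtain ⟨fg, gf, eg, ge⟩ := peirce_relations ff ff ef fe hg
  have xG : x * G = 0 := by rw [← xf, mul_assoc, fG, mul_zero]
  have Gy : G * y = 0 := by rw [← fy, ← mul_assoc, Gf, zero_mul]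
  have expand : 1 + a + b + b * a = G + g + x * g + g * y + x * g * y := by
    calc 1 + a + b + b * a = (1 + b) * (1 + a) := by noncomm_ring
      _ = G + g + x * g + g * y + x * g * y + x * G + G * y + x * G * y := by
        rw [main]; noncomm_ring
      _ = _ := by simp only [xG, Gy, zero_mul, add_zero]
  have row_e : e + a = G + x * g + x * g * y := by
    simpa only [mul_add, mul_one, ← mul_assoc, ea, eb, eG, eg, ex, zero_mul, add_zero, zero_add]
      using congrArg (e * ·) expand
  have row_f : f + b + b * a = g + g * y := by
    simpa only [mul_add, mul_one, ← mul_assoc, fa, fb, fG, fg, fx, zero_mul, add_zero, zero_add]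
      using congrArg (f * ·) expand
  refine ⟨?_, ?_, ?_, ?_⟩
  · simpa only [add_mul, mul_assoc, ee, ae, Ge, ge, ye, mul_zero, add_zero, zero_add]
      using congrArg (· * e) row_e
  · simpa only [add_mul, mul_assoc, ef, af, Gf, gf, yf, mul_zero, add_zero, zero_add]
      using congrArg (· * f) row_e
  · simpa only [add_mul, mul_assoc, fe, be, ae, ge, ye, mul_zero, add_zero, zero_add]
      using congrArg (· * e) row_f
  · simpa only [add_mul, mul_assoc, ff, bf, af, gf, yf, mul_zero, add_zero, zero_add]
      using congrArg (· * f) row_f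

/-- Lemma 4.2. The double quasi-Poisson bracket on the Boalch algebra
`B(I)` of the monochromatic interval, determined by its values on `v₁₂, v₂₁`, takes the
stated values on the remaining generators `w₁₂, w₂₁` (where `γ₂⁻¹` denotes the inverse
of `γ₂` in the corner `e₂ B(I) e₂`). -/
theorem statement_5 (𝕜 : Type) [Field 𝕜] [CharZero 𝕜]
    (D : DoubleBracket 𝕜 (BI 𝕜))
    (hB : VanishesOnIdem D (iIdem 𝕜))
    (h1 : D.br (iV12 𝕜) (iV12 𝕜) = 0)
    (h2 : D.br (iV21 𝕜) (iV21 𝕜) = 0)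
    (h3 : D.br (iV21 𝕜) (iV12 𝕜)
        = iE1 𝕜 ⊗ₜ[𝕜] iE2 𝕜
          + (2 : 𝕜)⁻¹ • ((iV12 𝕜 * iV21 𝕜) ⊗ₜ[𝕜] iE2 𝕜 + iE1 𝕜 ⊗ₜ[𝕜] (iV21 𝕜 * iV12 𝕜))) :
    D.br (iW21 𝕜) (iV21 𝕜)
        = (2 : 𝕜)⁻¹ • (iW21 𝕜 ⊗ₜ[𝕜] iV21 𝕜 + iV21 𝕜 ⊗ₜ[𝕜] iW21 𝕜)
    ∧ D.br (iW12 𝕜) (iV12 𝕜)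
        = - ((2 : 𝕜)⁻¹ • (iW12 𝕜 ⊗ₜ[𝕜] iV12 𝕜 + iV12 𝕜 ⊗ₜ[𝕜] iW12 𝕜))
    ∧ D.br (iW21 𝕜) (iV12 𝕜)
        = (2 : 𝕜)⁻¹ • (iE1 𝕜 ⊗ₜ[𝕜] iG2i 𝕜) + (2 : 𝕜)⁻¹ • (iG1 𝕜 ⊗ₜ[𝕜] iE2 𝕜)
    ∧ D.br (iW12 𝕜) (iV21 𝕜)
        = - ((2 : 𝕜)⁻¹ • (iG2i 𝕜 ⊗ₜ[𝕜] iE1 𝕜 + iE2 𝕜 ⊗ₜ[𝕜] iG1 𝕜))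
    ∧ D.br (iW12 𝕜) (iW12 𝕜) = 0
    ∧ D.br (iW21 𝕜) (iW21 𝕜) = 0
    ∧ D.br (iW21 𝕜) (iW12 𝕜)
        = iG1 𝕜 ⊗ₜ[𝕜] iG2i 𝕜
          - (2 : 𝕜)⁻¹ • ((iW12 𝕜 * iW21 𝕜) ⊗ₜ[𝕜] iE2 𝕜 + iE1 𝕜 ⊗ₜ[𝕜] (iW21 𝕜 * iW12 𝕜)) := by
  have rel {p q : FreeAlgebra 𝕜 IGen} (h : IRel 𝕜 p q) :
      RingQuot.mkAlgHom 𝕜 (IRel 𝕜) p = RingQuot.mkAlgHom 𝕜 (IRel 𝕜) q :=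
    RingQuot.mkAlgHom_rel 𝕜 h
  have ee : iE1 𝕜 * iE1 𝕜 = iE1 𝕜 := by simpa [iE1] using rel .e11
  have ff : iE2 𝕜 * iE2 𝕜 = iE2 𝕜 := by simpa [iE2] using rel .e22
  have ef : iE1 𝕜 * iE2 𝕜 = 0 := by simpa [iE1, iE2] using rel .e12
  have fe : iE2 𝕜 * iE1 𝕜 = 0 := by simpa [iE2, iE1] using rel .e21
  have ha : iV12 𝕜 = iE1 𝕜 * iV12 𝕜 * iE2 𝕜 := by simpa [iV12, iE1, iE2] using rel .v12s
  have hb : iV21 𝕜 = iE2 𝕜 * iV21 𝕜 * iE1 𝕜 := by simpa [iV21, iE2, iE1] using rel .v21s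
  have hx : iW12 𝕜 = iE1 𝕜 * iW12 𝕜 * iE2 𝕜 := by simpa [iW12, iE1, iE2] using rel .w12s
  have hy : iW21 𝕜 = iE2 𝕜 * iW21 𝕜 * iE1 𝕜 := by simpa [iW21, iE2, iE1] using rel .w21s
  have hG : iG1 𝕜 = iE1 𝕜 * iG1 𝕜 * iE1 𝕜 := by simpa [iG1, iE1] using rel .g1s
  have hg : iG2 𝕜 = iE2 𝕜 * iG2 𝕜 * iE2 𝕜 := by simpa [iG2, iE2] using rel .g2s
  have hh : iG2i 𝕜 = iE2 𝕜 * iG2i 𝕜 * iE2 𝕜 := by simpa [iG2i, iE2] using rel .g2is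
  have gh : iG2 𝕜 * iG2i 𝕜 = iE2 𝕜 := by simpa [iG2, iG2i, iE2] using rel .g2inv
  have hg' : iG2i 𝕜 * iG2 𝕜 = iE2 𝕜 := by simpa [iG2i, iG2, iE2] using rel .g2inv'
  have main : (1 + iV21 𝕜) * (1 + iV12 𝕜)
      = (1 + iW12 𝕜) * (iG1 𝕜 + iG2 𝕜) * (1 + iW21 𝕜) := by
    simpa [iV21, iV12, iW12, iG1, iG2, iW21] using rel .main
  obtain ⟨e_eq, a_eq, b_eq, g_eq⟩ :=
    peirce_components_of_factorization ee ff ef fe ha hb hx hy hG hg main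
  obtain ⟨ea, af, -, -⟩ := peirce_relations ee ff fe fe ha
  obtain ⟨fb, be, -, -⟩ := peirce_relations ff ee ef ef hb
  obtain ⟨fh, hf, -, -⟩ := peirce_relations ff ff ef fe hh
  have x_eq : iW12 𝕜 = iV12 𝕜 * iG2i 𝕜 := by
    rw [a_eq, mul_assoc, gh, (peirce_relations ee ff fe fe hx).2.1]
  have y_eq : iW21 𝕜 = iG2i 𝕜 * iV21 𝕜 := by
    rw [b_eq, ← mul_assoc, hg', (peirce_relations ff ee ef ef hy).1]
  have ahb : iV12 𝕜 * (iG2i 𝕜 * iV21 𝕜) = iE1 𝕜 - iG1 𝕜 := by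
    rw [← y_eq, a_eq, mul_assoc]
    exact eq_sub_of_add_eq' e_eq.symm
  rw [x_eq, y_eq]
  exact D.br_interval ea af fb be fh hf gh hg' (eq_sub_of_add_eq' g_eq) ahb (hB 1) h1 h2 h3

end NCQP
end

section
/- Consider a triple of generators (v_{ij}, v_{ji}, v_{ik}) of kQ̄_n with i, j, k pairwise distinct. Then the quasi-Poisson property {{v_{ij},v_{ji},v_{ik}}} = {{v_{ij},v_{ji},v_{ik}}}_qP holds if and only if the conditions in the applicable case below are all satisfied: (i) when i > j and k ≠ i, j: (1/2)(μ^{(i)}_{jk} + β^{(i)}_{jk}) + μ^{(i)}_{jk} β^{(i)}_{jk} = −1/4 and ν^{(i)}_{jk}(β^{(i)}_{jk} + 1/2) = 0; (ii) when k < i < j or i < j < k: (1/2)(μ^{(i)}_{jk} + β^{(i)}_{jk}) − μ^{(i)}_{jk} β^{(i)}_{jk} = 1/4 and ν^{(i)}_{jk}(β^{(i)}_{jk} − 1/2) = 0; (iii) when i < k < j: (1/2)(μ^{(i)}_{jk} + β^{(i)}_{jk}) − μ^{(i)}_{jk} β^{(i)}_{jk} = 1/4, ν^{(i)}_{jk}(β^{(i)}_{jk}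 − 1/2) + κ_k^{(j,i)} ν^{(k)}_{ij} = 0, and κ_k^{(j,i)}(α^{(k)}_{ij} + μ^{(k)}_{ij}) = 0. -/
open TensorProduct

namespace NCQP

variable (𝕜 : Type) [Field 𝕜] [CharZero 𝕜]

variable {𝕜}
variable {A : Type} [Ring A] [Algebra 𝕜 A]

variable (𝕜)

/-- Generators of the path algebra of the quiver `Q̄_n`: one idempotent `E i` per vertex
and one arrow `V i j : j → i` for each ordered pair of distinct vertices. -/
inductive QGen (n : ℕ) : Type
  | E : Fin n → QGen n
  | V : Fin n → Fin n → QGen n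

/-- The defining relations of the path algebra of `Q̄_n`. -/
inductive QRel (n : ℕ) : FreeAlgebra 𝕜 (QGen n) → FreeAlgebra 𝕜 (QGen n) → Prop
  | orth (i j : Fin n) :
      QRel n (FreeAlgebra.ι 𝕜 (QGen.E i) * FreeAlgebra.ι 𝕜 (QGen.E j))
        (if i = j then FreeAlgebra.ι 𝕜 (QGen.E i) else 0)
  | sum_one :
      QRel n (∑ i : Fin n, FreeAlgebra.ι 𝕜 (QGen.E i)) 1
  | supp (i j : Fin n) :
      QRel n (FreeAlgebra.ι 𝕜 (QGen.V i j))
        (FreeAlgebra.ι 𝕜 (QGen.E i) * FreeAlgebra.ι 𝕜 (QGen.V i j) *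
          FreeAlgebra.ι 𝕜 (QGen.E j))
  | diag (i : Fin n) :
      QRel n (FreeAlgebra.ι 𝕜 (QGen.V i i)) 0

/-- The path algebra `𝕜 Q̄_n` of the double of an ordering of the complete `n`-partite
graph on `n` vertices. -/
abbrev PathAlg (n : ℕ) : Type := RingQuot (QRel 𝕜 n)

/-- The vertex idempotents `e i` of `𝕜 Q̄_n`. -/
noncomputable def pe (n : ℕ) (i : Fin n) : PathAlg 𝕜 n :=
  RingQuot.mkAlgHom 𝕜 (QRel 𝕜 n) (FreeAlgebra.ι 𝕜 (QGen.E i))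

/-- The arrows `v i j : j → i` of `𝕜 Q̄_n`. -/
noncomputable def pv (n : ℕ) (i j : Fin n) : PathAlg 𝕜 n :=
  RingQuot.mkAlgHom 𝕜 (QRel 𝕜 n) (FreeAlgebra.ι 𝕜 (QGen.V i j))

/-- The data of coefficient matrices `α, β, μ, ν` and scalars `κ`, together with a
`B`-linear double bracket on the path algebra `𝕜 Q̄_n` whose values on the generators
are given by the formulas (vv0)–(vvopp); `α s i j` stands for `α^{(s)}_{ij}` and
`κ i a j` stands for `κ_a^{(i,j)}`. -/
structure BracketData (n : ℕ) where
  α : Fin n → Fin n → Fin n → 𝕜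
  β : Fin n → Fin n → Fin n → 𝕜
  μ : Fin n → Fin n → Fin n → 𝕜
  ν : Fin n → Fin n → Fin n → 𝕜
  κ : Fin n → Fin n → Fin n → 𝕜
  D : DoubleBracket 𝕜 (PathAlg 𝕜 n)
  hα_skew : ∀ s i j, α s i j = - α s j i
  hα_row : ∀ s j, α s s j = 0
  hα_col : ∀ s j, α s j s = 0
  hβ_skew : ∀ s i j, β s i j = - β s j i
  hβ_row : ∀ s j, β s s j = 0
  hβ_col : ∀ s j, β s j s = 0
  hμ_diag : ∀ s i, μ s i i = 0
  hμ_row : ∀ s j, μ s s j = 0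
  hμ_col : ∀ s j, μ s j s = 0
  hν_diag : ∀ s i, ν s i i = 0
  hν_row : ∀ s j, ν s s j = 0
  hν_col : ∀ s j, ν s j s = 0
  hκ : ∀ i a j, ¬ (j < a ∧ a < i) → κ i a j = 0
  /-- the bracket vanishes on the idempotents, i.e. it is `B`-linear -/
  hB : ∀ s, D.br (pe 𝕜 n s) = 0
  hvv : ∀ i j, D.br (pv 𝕜 n i j) (pv 𝕜 n i j) = 0
  hdisj : ∀ i j p q, i ≠ p → i ≠ q → j ≠ p → j ≠ q →
    D.br (pv 𝕜 n i j) (pv 𝕜 n p q) = 0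
  hbr_α : ∀ i j l, i ≠ j → l ≠ j →
    D.br (pv 𝕜 n i j) (pv 𝕜 n l j) = α j i l • (pv 𝕜 n l j ⊗ₜ[𝕜] pv 𝕜 n i j)
  hbr_β : ∀ i j l, j ≠ i → l ≠ i →
    D.br (pv 𝕜 n i j) (pv 𝕜 n i l) = β i j l • (pv 𝕜 n i j ⊗ₜ[𝕜] pv 𝕜 n i l)
  hbr_μν : ∀ i j l, i ≠ j → l ≠ j → i ≠ l →
    D.br (pv 𝕜 n i j) (pv 𝕜 n j l) =
      μ j i l • (pe 𝕜 n j ⊗ₜ[𝕜] (pv 𝕜 n i j * pv 𝕜 n j l))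
      + ν j i l • (pe 𝕜 n j ⊗ₜ[𝕜] pv 𝕜 n i l)
  hbr_μν' : ∀ i j l, i ≠ j → l ≠ i → l ≠ j →
    D.br (pv 𝕜 n i j) (pv 𝕜 n l i) =
      - (μ i l j • ((pv 𝕜 n l i * pv 𝕜 n i j) ⊗ₜ[𝕜] pe 𝕜 n i))
      - ν i l j • (pv 𝕜 n l j ⊗ₜ[𝕜] pe 𝕜 n i)
  hbr_loop : ∀ i j, i ≠ j →
    D.br (pv 𝕜 n i j) (pv 𝕜 n j i) =
      (if j < i then (1 : 𝕜) else -1) •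
        ( pe 𝕜 n j ⊗ₜ[𝕜] pe 𝕜 n i
          + (2 : 𝕜)⁻¹ • ((pv 𝕜 n j i * pv 𝕜 n i j) ⊗ₜ[𝕜] pe 𝕜 n i)
          + (2 : 𝕜)⁻¹ • (pe 𝕜 n j ⊗ₜ[𝕜] (pv 𝕜 n i j * pv 𝕜 n j i)) )
      + ∑ a : Fin n, κ i a j • (pe 𝕜 n j ⊗ₜ[𝕜] (pv 𝕜 n i a * pv 𝕜 n a i))
      - ∑ b : Fin n, κ j b i • ((pv 𝕜 n j b * pv 𝕜 n b j) ⊗ₜ[𝕜] pe 𝕜 n i)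


section PathAlgebra

variable {K : Type} [Field K] {R : Type} [Ring R] [Algebra K R] {n : ℕ}

lemma pe_mul_pe (i j : Fin n) : pe K n i * pe K n j = if i = j then pe K n i else 0 := by
  have h := RingQuot.mkAlgHom_rel K (QRel.orth (𝕜 := K) i j)
  rw [map_mul, apply_ite (RingQuot.mkAlgHom K (QRel K n)), map_zero] at h
  exact h

lemma pe_mul_pv_mul_pe (i j : Fin n) : pe K n i * pv K n i j * pe K n j = pv K n i j := by
  have h := RingQuot.mkAlgHom_rel K (QRel.supp (𝕜 := K) i j)
  rw [map_mul, map_mul] at h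
  exact h.symm

lemma pe_mul_pv (s i j : Fin n) :
    pe K n s * pv K n i j = if s = i then pv K n i j else 0 := by
  rw [← pe_mul_pv_mul_pe i j, ← mul_assoc, ← mul_assoc, pe_mul_pe]
  split_ifs with h <;> simp [h]

lemma pv_mul_pe (s i j : Fin n) :
    pv K n i j * pe K n s = if s = j then pv K n i j else 0 := by
  rw [← pe_mul_pv_mul_pe i j, mul_assoc, pe_mul_pe]
  split_ifs with h h' h' <;> simp_all

/-- The value of the weighted matrix representation on the generators. -/
def genMatrix (x : Fin n → Fin n → K) : QGen n → Matrix (Fin n) (Fin n) K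
  | QGen.E i => Matrix.single i i 1
  | QGen.V i j => Matrix.single i j (if i = j then 0 else x i j)

/-- The representation of the path algebra sending the arrow `v i j` to the elementary matrix
at `(i, j)` with coefficient `x i j`. -/
noncomputable def matrixRep (x : Fin n → Fin n → K) :
    PathAlg K n →ₐ[K] Matrix (Fin n) (Fin n) K :=
  RingQuot.liftAlgHom K ⟨FreeAlgebra.lift K (genMatrix x), by
    intro a b h
    cases h with
    | orth i j =>
      by_cases h : i = j
      · subst h; simp [genMatrix]
      · simp [genMatrix, h]
    | sum_one =>
      simp only [map_sum, FreeAlgebra.lift_ι_apply, genMatrix, map_one]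
      exact Matrix.sum_single_one
    | supp i j => simp [genMatrix]
    | diag i => simp [genMatrix]⟩

lemma matrixRep_pe (x : Fin n → Fin n → K) (i : Fin n) :
    matrixRep x (pe K n i) = Matrix.single i i 1 := by
  simp [matrixRep, pe, genMatrix]

lemma matrixRep_pv (x : Fin n → Fin n → K) {i j : Fin n} (h : i ≠ j) :
    matrixRep x (pv K n i j) = Matrix.single i j (x i j) := by
  simp [matrixRep, pv, genMatrix, h]

/-- The `(p, q)` matrix coefficient of the representation with weights `x`. -/
noncomputable def matrixCoeff (x : Fin n → Fin n → K) (p q : Fin n) : PathAlg K n →ₗ[K] K :=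
  (Matrix.entryLinearMap K K p q).comp (matrixRep x).toLinearMap

lemma matrixCoeff_apply (x : Fin n → Fin n → K) (p q : Fin n) (a : PathAlg K n) :
    matrixCoeff x p q a = matrixRep x a p q := rfl

lemma matrixCoeff_pe (x : Fin n → Fin n → K) (i : Fin n) : matrixCoeff x i i (pe K n i) = 1 := by
  simp [matrixCoeff_apply, matrixRep_pe]

lemma matrixCoeff_pv (x : Fin n → Fin n → K) {i j : Fin n} (h : i ≠ j) :
    matrixCoeff x i j (pv K n i j) = x i j := by
  simp [matrixCoeff_apply, matrixRep_pv x h]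

lemma matrixCoeff_pv_mul_pv (x : Fin n → Fin n → K) {i j l : Fin n} (h : i ≠ j) (h' : j ≠ l) :
    matrixCoeff x i l (pv K n i j * pv K n j l) = x i j * x j l := by
  simp [matrixCoeff_apply, matrixRep_pv x h, matrixRep_pv x h']

/-- The product of three linear functionals, as a functional on the triple tensor product. -/
noncomputable def tensorFunctional (f g h : R →ₗ[K] K) : R ⊗[K] (R ⊗[K] R) →ₗ[K] K :=
  (LinearMap.mul' K K).comp
    (TensorProduct.map f ((LinearMap.mul' K K).comp (TensorProduct.map g h)))

lemma tensorFunctional_tmul (f g h : R →ₗ[K] K) (a b c : R) :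
    tensorFunctional f g h (a ⊗ₜ[K] (b ⊗ₜ[K] c)) = f a * (g b * h c) := by
  simp [tensorFunctional]

/-- Comparison of coefficients for three linearly independent pure tensors of paths. -/
lemma path_tensors_eq_iff {i j m : Fin n} (hij : i ≠ j) (him : i ≠ m) (hjm : j ≠ m)
    (a b c d : K) :
    a • (pv K n i j ⊗ₜ[K] (pe K n i ⊗ₜ[K] (pv K n j i * pv K n i m)))
      + b • (pv K n i j ⊗ₜ[K] (pe K n i ⊗ₜ[K] pv K n j m))
      + c • ((pv K n i m * pv K n m j) ⊗ₜ[K] (pe K n i ⊗ₜ[K] pv K n j m))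
        = d • (pv K n i j ⊗ₜ[K] (pe K n i ⊗ₜ[K] (pv K n j i * pv K n i m)))
      ↔ a = d ∧ b = 0 ∧ c = 0 := by
  refine ⟨fun h => ?_, fun ⟨ha, hb, hc⟩ => by simp [ha, hb, hc]⟩
  have key (x y : Fin n → Fin n → K) :
      a * (x i j * (y j i * y i m)) + b * (x i j * y j m) + c * (x i m * x m j * y j m)
        = d * (x i j * (y j i * y i m)) := by
    have := congrArg (tensorFunctional (matrixCoeff x i j) (matrixCoeff x i i)
      (matrixCoeff y j m)) h
    simpa [tensorFunctional_tmul, matrixCoeff_pe, matrixCoeff_pv, matrixCoeff_pv_mul_pv,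
      hij, him, hjm, hij.symm, hjm.symm] using this
  refine ⟨?_, ?_, ?_⟩
  · simpa [hij, him, hjm, hij.symm, him.symm, hjm.symm] using
      key (fun p q => if p = i ∧ q = j then 1 else 0) (fun p q => if p = j ∧ q = m then 0 else 1)
  · simpa [hij, him, hjm, hij.symm, him.symm, hjm.symm] using
      key (fun p q => if p = i ∧ q = j then 1 else 0) (fun p q => if p = j ∧ q = m then 1 else 0)
  · simpa [hij, him, hjm, hij.symm, him.symm, hjm.symm] using
      key (fun p q => if p = i ∧ q = j then 0 else 1) (fun p q => if p = j ∧ q = m then 1 else 0)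

lemma tau132_tmul (a b c : R) :
    tau132 K R (a ⊗ₜ[K] (b ⊗ₜ[K] c)) = b ⊗ₜ[K] (c ⊗ₜ[K] a) := by
  simp [tau132]

lemma tau123_tmul (a b c : R) :
    tau123 K R (a ⊗ₜ[K] (b ⊗ₜ[K] c)) = c ⊗ₜ[K] (a ⊗ₜ[K] b) := by
  simp [tau123, tau132_tmul]

lemma extL_tmul (φ : R →ₗ[K] R ⊗[K] R) (b c : R) :
    extL K R φ (b ⊗ₜ[K] c) = TensorProduct.assoc K R R R (φ b ⊗ₜ[K] c) := rfl

lemma tripleQP_pv {i j m : Fin n} (hij : i ≠ j) (him : i ≠ m) (hjm : j ≠ m) :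
    tripleQP (pe K n) (pv K n i j) (pv K n j i) (pv K n i m)
      = (4 : K)⁻¹ • (pv K n i j ⊗ₜ[K] (pe K n i ⊗ₜ[K] (pv K n j i * pv K n i m))) := by
  unfold tripleQP
  congr 1
  rw [Finset.sum_eq_single i]
  · simp [pe_mul_pv, pv_mul_pe, hij, him]
  · intro s _ hs
    by_cases hj : s = j
    · subst hj
      simp [pe_mul_pv, pv_mul_pe, hs, hjm]
    · simp [pe_mul_pv, pv_mul_pe, hs, hj]
  · simp

lemma br_pv_return_path (S : BracketData K n) {i j m : Fin n} (hij : i ≠ j) (him : i ≠ m)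
    (hjm : j ≠ m) :
    S.D.br (pv K n i m) (pv K n j i * pv K n i j)
      = -(S.β i j m + S.μ i j m) • ((pv K n j i * pv K n i m) ⊗ₜ[K] pv K n i j)
        - S.ν i j m • (pv K n j m ⊗ₜ[K] pv K n i j) := by
  rw [S.D.leibniz, S.hbr_μν' i m j him hij.symm hjm, S.hbr_β i m j him.symm hij.symm,
    S.hβ_skew i m j]
  simp only [sub_mul, neg_mul, smul_mul_assoc, mul_smul_comm,
    Algebra.TensorProduct.tmul_mul_tmul, mul_one, one_mul, pe_mul_pv, if_true]
  module

lemma br_pv_detour (S : BracketData K n) {i j m : Fin n} (hij : i ≠ j) (him : i ≠ m)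
    (hjm : j ≠ m) :
    S.D.br (pv K n i m) (pv K n j m * pv K n m j)
      = (S.α m i j + S.μ m i j) • (pv K n j m ⊗ₜ[K] (pv K n i m * pv K n m j))
        + S.ν m i j • (pv K n j m ⊗ₜ[K] pv K n i j) := by
  rw [S.D.leibniz, S.hbr_α i m j him hjm, S.hbr_μν i m j him hjm hij]
  simp only [mul_add, smul_mul_assoc, mul_smul_comm,
    Algebra.TensorProduct.tmul_mul_tmul, mul_one, one_mul, pv_mul_pe, if_true]
  module

lemma br_pv_detour_eq_zero (S : BracketData K n) {i j m b : Fin n} (hij : i ≠ j)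
    (hjm : j ≠ m) (hbi : b ≠ i) (hbm : b ≠ m) :
    S.D.br (pv K n i m) (pv K n j b * pv K n b j) = 0 := by
  rw [S.D.leibniz, S.hdisj i m j b hij hbi.symm hjm.symm hbm.symm,
    S.hdisj i m b j hbi.symm hij hbm.symm hjm.symm]
  simp

lemma tripleBr_pv [CharZero K] (S : BracketData K n) {i j m : Fin n} (hij : i ≠ j) (him : i ≠ m)
    (hjm : j ≠ m) :
    tripleBr S.D (pv K n i j) (pv K n j i) (pv K n i m)
      = -(S.μ i j m * S.β i j m
            + (if j < i then (1 : K) else -1) * ((2 : K)⁻¹ * (S.μ i j m + S.β i j m)))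
          • (pv K n i j ⊗ₜ[K] (pe K n i ⊗ₜ[K] (pv K n j i * pv K n i m)))
        + -(S.ν i j m * (S.β i j m + (if j < i then (1 : K) else -1) * (2 : K)⁻¹)
            + S.κ j m i * S.ν m i j)
          • (pv K n i j ⊗ₜ[K] (pe K n i ⊗ₜ[K] pv K n j m))
        + -(S.κ j m i * (S.α m i j + S.μ m i j))
          • ((pv K n i m * pv K n m j) ⊗ₜ[K] (pe K n i ⊗ₜ[K] pv K n j m)) := by
  have hsum : (∑ b : Fin n, S.κ j b i •
      S.D.br (pv K n i m) (pv K n j b * pv K n b j))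
      = S.κ j m i • S.D.br (pv K n i m) (pv K n j m * pv K n m j) := by
    refine Finset.sum_eq_single m (fun b _ hbm => ?_) (by simp)
    by_cases hbi : b = i
    · rw [hbi, S.hκ j i i (by simp), zero_smul]
    · rw [br_pv_detour_eq_zero S hij hjm hbi hbm, smul_zero]
  have hai : S.D.br (pv K n i j) (pe K n i) = 0 := by
    rw [S.D.cyclic, S.hB]; simp
  have hcj : S.D.br (pv K n i m) (pe K n j) = 0 := by
    rw [S.D.cyclic, S.hB]; simp
  have hdetour : extL K _ (S.D.br (pv K n i m)) (∑ b : Fin n, S.κ j b i •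
      ((pv K n j b * pv K n b j) ⊗ₜ[K] pe K n i))
      = TensorProduct.assoc K _ _ _
        ((S.κ j m i • S.D.br (pv K n i m) (pv K n j m * pv K n m j)) ⊗ₜ[K] pe K n i) := by
    rw [← hsum]
    simp only [map_sum, map_smul, extL_tmul, TensorProduct.sum_tmul, TensorProduct.smul_tmul']
  unfold tripleBr
  rw [S.hbr_μν j i m hij.symm him.symm hjm, S.hbr_β i m j him.symm hij.symm, S.hbr_loop i j hij,
    map_sub (extL K _ _), hdetour, br_pv_detour S hij him hjm]
  simp only [map_add, map_sub, map_smul, map_sum, extL_tmul, hai, hcj,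
    br_pv_return_path S hij him hjm, S.hbr_μν j i m hij.symm him.symm hjm,
    TensorProduct.add_tmul, TensorProduct.sub_tmul, TensorProduct.zero_tmul,
    ← TensorProduct.smul_tmul', TensorProduct.assoc_tmul, tau132_tmul, tau123_tmul,
    map_zero, smul_zero, Finset.sum_const_zero, S.hβ_skew i m j]
  module

end PathAlgebra

/-- Case 3.2.b, Lemma 5.9. For a triple `(v_{ij}, v_{ji}, v_{ik})`
with `i, j, k` pairwise distinct, the quasi-Poisson property holds iff the conditions in
the applicable case among (i), (ii), (iii) are all satisfied. Here `m` plays the role of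
the index `k`. -/
theorem statement_16 {𝕜 : Type} [Field 𝕜] [CharZero 𝕜] {n : ℕ}
    (S : BracketData 𝕜 n) (i j m : Fin n)
    (hij : i ≠ j) (him : i ≠ m) (hjm : j ≠ m) :
    tripleBr S.D (pv 𝕜 n i j) (pv 𝕜 n j i) (pv 𝕜 n i m)
        = tripleQP (pe 𝕜 n) (pv 𝕜 n i j) (pv 𝕜 n j i) (pv 𝕜 n i m)
      ↔ ( (j < i →
              ( ((2 : 𝕜)⁻¹ * (S.μ i j m + S.β i j m) + S.μ i j m * S.β i j m
                    = -(4 : 𝕜)⁻¹)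
              ∧ (S.ν i j m * (S.β i j m + (2 : 𝕜)⁻¹) = 0) ))
        ∧ ((m < i ∧ i < j) ∨ (i < j ∧ j < m) →
              ( ((2 : 𝕜)⁻¹ * (S.μ i j m + S.β i j m) - S.μ i j m * S.β i j m
                    = (4 : 𝕜)⁻¹)
              ∧ (S.ν i j m * (S.β i j m - (2 : 𝕜)⁻¹) = 0) ))
        ∧ (i < m ∧ m < j →
              ( ((2 : 𝕜)⁻¹ * (S.μ i j m + S.β i j m) - S.μ i j m * S.β i j m
                    = (4 : 𝕜)⁻¹)
              ∧ (S.ν i j m * (S.β i j m - (2 : 𝕜)⁻¹) + S.κ j m i * S.ν m i j = 0)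
              ∧ (S.κ j m i * (S.α m i j + S.μ m i j) = 0) )) ) := by
  rw [tripleBr_pv S hij him hjm, tripleQP_pv hij him hjm, path_tensors_eq_iff hij him hjm]
  rcases lt_or_gt_of_ne hij with h | h
  · have hκ : ¬ (i < m ∧ m < j) → S.κ j m i = 0 := S.hκ j m i
    simp only [not_lt_of_gt h, if_false, h, true_and, and_true, false_imp_iff]
    by_cases hm : i < m ∧ m < j
    · have hm' : ¬ (m < i ∨ j < m) := by omega
      simp only [hm, hm', true_imp_iff, false_imp_iff, true_and, and_self]
      grind
    · have hm' : m < i ∨ j < m := by omega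
      simp only [hκ hm, hm, hm', true_imp_iff, false_imp_iff, and_true]
      grind
  · have hκ : S.κ j m i = 0 := S.hκ j m i (by omega)
    have hm : ¬ (i < m ∧ m < j) := by omega
    have hm' : ¬ (m < i ∧ i < j ∨ i < j ∧ j < m) := by omega
    simp only [hκ, hm, hm', h, if_true, true_imp_iff, false_imp_iff, and_true]
    grind

end NCQP
end
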